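/- arXiv:2007.14111 — 3 statements merged into one kernel-verified Lean document; each statement's English description precedes it below -/
import Mathlib

section
/- For each r ≥ 0, c_{ω^{r+1}}(n) ~ n^r / (r! · (r+1)!) as n → ∞; that is, the number of partitions of n into parts of size at most r+1 is asymptotically n^r / (r! · ∏_{i=1}^{r+1} i). -/
open Ordinal

/-- `ε₀` is the least ordinal `ξ` with `ω ^ ξ = ξ`. -/
noncomputable def eps0 : Ordinal := sInf {ξ : Ordinal | omega0 ^ ξ = ξ}

/-- `N` is the norm function on ordinals below `ε₀`: `N 0 = 0` and
`N (ω^e + b) = 1 + N e + N b` when `ω^e + b` is in Cantor normal form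
(i.e. `b < ω^(e+1)`).  Thus `N α` is the number of occurrences of `ω` in the
hereditary Cantor normal form of `α`. -/
def IsNorm (N : Ordinal → ℕ) : Prop :=
  N 0 = 0 ∧
    ∀ e b : Ordinal, omega0 ^ e + b < eps0 → b < omega0 ^ (e + 1) →
      N (omega0 ^ e + b) = 1 + N e + N b

universe u

/-- The ordinals below `ω ^ k` of norm `n`. -/
def normLevel (N : Ordinal.{u} → ℕ) (k n : ℕ) : Set Ordinal.{u} :=
  {α | α < omega0 ^ (k : Ordinal.{u}) ∧ N α = n}

theorem omega0_opow_eps0 : omega0 ^ eps0.{u} = eps0.{u} :=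
  csInf_mem (s := {ξ : Ordinal.{u} | omega0 ^ ξ = ξ})
    ⟨nfp (omega0 ^ ·) 0, nfp_fp (isNormal_opow one_lt_omega0) 0⟩

theorem natCast_lt_eps0 (k : ℕ) : (k : Ordinal.{u}) < eps0 := by
  induction k with
  | zero =>
    rw [← omega0_opow_eps0]
    exact_mod_cast opow_pos _ omega0_pos
  | succ k ih =>
    rw [← omega0_opow_eps0]
    refine (natCast_lt_omega0 _).trans_le (left_le_opow _ ?_)
    exact lt_of_le_of_lt zero_le ih

theorem omega0_opow_natCast_lt_eps0 (k : ℕ) : omega0 ^ (k : Ordinal.{u}) < eps0 := by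
  conv_rhs => rw [← omega0_opow_eps0]
  exact (opow_lt_opow_iff_right one_lt_omega0).2 (natCast_lt_eps0 k)

theorem omega0_opow_natCast_add_lt {k : ℕ} {b : Ordinal.{u}}
    (hb : b < omega0 ^ ((k + 1 : ℕ) : Ordinal.{u})) :
    omega0 ^ (k : Ordinal.{u}) + b < omega0 ^ ((k + 1 : ℕ) : Ordinal.{u}) :=
  isPrincipal_add_omega0_opow _
    ((opow_lt_opow_iff_right one_lt_omega0).2 (by exact_mod_cast k.lt_succ_self)) hb

namespace IsNorm

variable {N : Ordinal.{u} → ℕ}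

theorem omega0_opow_add (hN : IsNorm N) {k : ℕ} {b : Ordinal.{u}}
    (hb : b < omega0 ^ ((k + 1 : ℕ) : Ordinal.{u})) :
    N (omega0 ^ (k : Ordinal.{u}) + b) = 1 + N k + N b :=
  hN.2 _ _ ((omega0_opow_natCast_add_lt hb).trans (omega0_opow_natCast_lt_eps0 _))
    (by simpa using hb)

theorem natCast (hN : IsNorm N) (k : ℕ) : N k = k := by
  induction k with
  | zero => simpa using hN.1
  | succ k ih =>
    have h := hN.omega0_opow_add (k := 0) (b := k) (by simp)
    have h0 : N ((0 : ℕ) : Ordinal.{u}) = 0 := by simpa using hN.1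
    have hk : omega0 ^ ((0 : ℕ) : Ordinal.{u}) + k = ((k + 1 : ℕ) : Ordinal.{u}) := by
      rw [Nat.cast_zero, opow_zero, ← Nat.cast_one, ← Nat.cast_add, add_comm]
    rw [← hk, h, h0, ih]
    omega

theorem normLevel_zero (hN : IsNorm N) (n : ℕ) :
    normLevel N 0 n = if n = 0 then {0} else ∅ := by
  have h0 := hN.1
  ext α
  split_ifs with hn
  · simp only [normLevel, Nat.cast_zero, opow_zero, Set.mem_ofPred_eq, Set.mem_singleton_iff,
      Order.lt_one_iff]
    exact ⟨fun h => h.1, fun h => ⟨h, by rw [h, h0, hn]⟩⟩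
  · simp only [normLevel, Nat.cast_zero, opow_zero, Set.mem_ofPred_eq, Set.mem_empty_iff_false,
      Order.lt_one_iff, iff_false]
    rintro ⟨rfl, h⟩
    omega

theorem normLevel_succ (hN : IsNorm N) (k n : ℕ) :
    normLevel N (k + 1) n = normLevel N k n ∪
      (omega0 ^ (k : Ordinal.{u}) + ·) '' {b ∈ ⋃ m, normLevel N (k + 1) m | N b + (k + 1) = n} := by
  have hle : omega0 ^ (k : Ordinal.{u}) ≤ omega0 ^ ((k + 1 : ℕ) : Ordinal.{u}) :=
    opow_le_opow_right omega0_pos (by exact_mod_cast k.le_succ)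
  ext α
  simp only [normLevel, Set.mem_union, Set.mem_image, Set.mem_ofPred_eq, Set.mem_iUnion]
  constructor
  · rintro ⟨hα, rfl⟩
    rcases lt_or_ge α (omega0 ^ (k : Ordinal.{u})) with h | h
    · exact Or.inl ⟨h, rfl⟩
    · have hb := (sub_le_self α (omega0 ^ (k : Ordinal.{u}))).trans_lt hα
      have h1 := hN.omega0_opow_add hb
      rw [Ordinal.add_sub_cancel_of_le h, hN.natCast] at h1
      exact Or.inr ⟨_, ⟨⟨_, hb, rfl⟩, by omega⟩, Ordinal.add_sub_cancel_of_le h⟩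
  · rintro (⟨h, rfl⟩ | ⟨b, ⟨⟨m, hb, -⟩, rfl⟩, rfl⟩)
    · exact ⟨h.trans_le hle, rfl⟩
    · refine ⟨omega0_opow_natCast_add_lt hb, ?_⟩
      rw [hN.omega0_opow_add hb, hN.natCast]
      omega

theorem normLevel_succ_of_le (hN : IsNorm N) {k n : ℕ} (hn : n ≤ k) :
    normLevel N (k + 1) n = normLevel N k n := by
  rw [hN.normLevel_succ, Set.union_eq_left]
  rintro _ ⟨b, ⟨-, hb⟩, rfl⟩
  omega

theorem normLevel_succ_add (hN : IsNorm N) (k n : ℕ) :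
    normLevel N (k + 1) (n + (k + 1)) = normLevel N k (n + (k + 1)) ∪
      (omega0 ^ (k : Ordinal.{u}) + ·) '' normLevel N (k + 1) n := by
  rw [hN.normLevel_succ]
  congr 2
  ext b
  simp [normLevel]

theorem finite_normLevel (hN : IsNorm N) (k n : ℕ) : (normLevel N k n).Finite := by
  induction k generalizing n with
  | zero =>
    rw [hN.normLevel_zero]
    split_ifs <;> simp
  | succ k ih =>
    induction n using Nat.strong_induction_on with
    | _ n ihn =>
      rcases le_or_gt n k with hn | hn
      · rw [hN.normLevel_succ_of_le hn]
        exact ih n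
      · obtain ⟨m, rfl⟩ := Nat.exists_eq_add_of_le' hn
        rw [hN.normLevel_succ_add]
        exact (ih _).union ((ihn m (by omega)).image _)

theorem ncard_normLevel_succ_add (hN : IsNorm N) (k n : ℕ) :
    (normLevel N (k + 1) (n + (k + 1))).ncard =
      (normLevel N k (n + (k + 1))).ncard + (normLevel N (k + 1) n).ncard := by
  rw [hN.normLevel_succ_add, Set.ncard_union_eq _ (hN.finite_normLevel _ _)
    ((hN.finite_normLevel _ _).image _), Set.ncard_image_of_injective _ (add_right_injective _)]
  rw [Set.disjoint_left]
  rintro _ ⟨h, -⟩ ⟨b, -, rfl⟩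
  exact (le_self_add.trans_lt h).false

theorem ncard_normLevel_one (hN : IsNorm N) (n : ℕ) : (normLevel N 1 n).ncard = 1 := by
  induction n with
  | zero => simp [hN.normLevel_succ_of_le le_rfl, hN.normLevel_zero]
  | succ n ih => simpa [hN.normLevel_zero, ih] using hN.ncard_normLevel_succ_add 0 n

end IsNorm

theorem pow_succ_add_le_add_pow (x d r : ℕ) :
    x ^ (r + 1) + (r + 1) * d * x ^ r ≤ (x + d) ^ (r + 1) := by
  induction r with
  | zero => simp
  | succ r ih =>
    calc x ^ (r + 2) + (r + 1 + 1) * d * x ^ (r + 1)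
        ≤ x ^ (r + 2) + (r + 1 + 1) * d * x ^ (r + 1) + (r + 1) * d * d * x ^ r :=
          Nat.le_add_right _ _
      _ = (x ^ (r + 1) + (r + 1) * d * x ^ r) * (x + d) := by ring
      _ ≤ (x + d) ^ (r + 1) * (x + d) := Nat.mul_le_mul_right _ ih

theorem add_pow_le_pow_succ_add (x d r : ℕ) :
    (x + d) ^ (r + 1) ≤ x ^ (r + 1) + (r + 1) * d * (x + d) ^ r := by
  induction r with
  | zero => simp
  | succ r ih =>
    have h : x ^ (r + 1) ≤ (x + d) ^ (r + 1) := Nat.pow_le_pow_left (Nat.le_add_right _ _) _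
    calc (x + d) ^ (r + 2) = (x + d) ^ (r + 1) * x + d * (x + d) ^ (r + 1) := by ring
      _ ≤ (x ^ (r + 1) + (r + 1) * d * (x + d) ^ r) * x + d * (x + d) ^ (r + 1) := by gcongr
      _ ≤ (x ^ (r + 1) + (r + 1) * d * (x + d) ^ r) * x + d * (x + d) ^ (r + 1)
          + (r + 1) * d * (x + d) ^ r * d := Nat.le_add_right _ _
      _ = x ^ (r + 2) + (r + 1 + 1) * d * (x + d) ^ (r + 1) := by ring

theorem factorial_mul_factorial_succ (r : ℕ) :
    (r + 1).factorial * (r + 2).factorial =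
      (r + 1) * (r + 2) * (r.factorial * (r + 1).factorial) := by
  rw [Nat.factorial_succ (r + 1), Nat.factorial_succ r]
  ring

namespace IsNorm

variable {N : Ordinal.{u} → ℕ}

theorem pow_le_mul_ncard_normLevel (hN : IsNorm N) (r n : ℕ) :
    n ^ r ≤ r.factorial * (r + 1).factorial * (normLevel N (r + 1) n).ncard := by
  induction r generalizing n with
  | zero => simp [hN.ncard_normLevel_one]
  | succ r ih =>
    rw [factorial_mul_factorial_succ]
    induction n using Nat.strong_induction_on with
    | _ n ihn =>
      rcases le_or_gt n (r + 1) with hn | hn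
      · rw [hN.normLevel_succ_of_le hn]
        calc n ^ (r + 1) = n * n ^ r := by ring
          _ ≤ ((r + 1) * (r + 2)) * (r.factorial * (r + 1).factorial *
              (normLevel N (r + 1) n).ncard) := Nat.mul_le_mul (by nlinarith) (ih n)
          _ = _ := by ring
      · obtain ⟨m, rfl⟩ := Nat.exists_eq_add_of_le' hn
        change (m + (r + 1 + 1)) ^ (r + 1) ≤ _ * (normLevel N (r + 1 + 1) (m + (r + 1 + 1))).ncard
        rw [hN.ncard_normLevel_succ_add, mul_add]
        calc (m + (r + 1 + 1)) ^ (r + 1)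
            ≤ m ^ (r + 1) + (r + 1) * (r + 2) * (m + (r + 1 + 1)) ^ r :=
              add_pow_le_pow_succ_add _ _ _
          _ ≤ _ + (r + 1) * (r + 2) * (r.factorial * (r + 1).factorial *
              (normLevel N (r + 1) (m + (r + 1 + 1))).ncard) :=
              Nat.add_le_add (ihn m (by omega)) (Nat.mul_le_mul_left _ (ih _))
          _ = _ := by ring

theorem exists_mul_ncard_normLevel_le (hN : IsNorm N) (r : ℕ) :
    ∃ s : ℕ, ∀ n : ℕ,
      r.factorial * (r + 1).factorial * (normLevel N (r + 1) n).ncard ≤ (n + s) ^ r := by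
  induction r with
  | zero => exact ⟨0, fun n => by simp [hN.ncard_normLevel_one]⟩
  | succ r ih =>
    obtain ⟨s, hs⟩ := ih
    refine ⟨s + (r + 1 + 1), fun n => ?_⟩
    rw [factorial_mul_factorial_succ]
    induction n using Nat.strong_induction_on with
    | _ n ihn =>
      rcases le_or_gt n (r + 1) with hn | hn
      · rw [hN.normLevel_succ_of_le hn]
        calc _ = ((r + 1) * (r + 2)) * (r.factorial * (r + 1).factorial *
              (normLevel N (r + 1) n).ncard) := by ring
          _ ≤ (r + 1) * (r + 2) * (n + s) ^ r := Nat.mul_le_mul_left _ (hs n)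
          _ ≤ (n + s) ^ (r + 1) + (r + 1) * (r + 2) * (n + s) ^ r := Nat.le_add_left _ _
          _ ≤ (n + s + (r + 2)) ^ (r + 1) := pow_succ_add_le_add_pow _ _ _
          _ = _ := by ring
      · obtain ⟨m, rfl⟩ := Nat.exists_eq_add_of_le' hn
        change _ * (normLevel N (r + 1 + 1) (m + (r + 1 + 1))).ncard ≤
          (m + (r + 1 + 1) + (s + (r + 1 + 1))) ^ (r + 1)
        rw [hN.ncard_normLevel_succ_add, mul_add]
        calc _ = (r + 1) * (r + 2) * (r.factorial * (r + 1).factorial *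
              (normLevel N (r + 1) (m + (r + 1 + 1))).ncard) +
              (r + 1) * (r + 2) * (r.factorial * (r + 1).factorial) *
                (normLevel N (r + 1 + 1) m).ncard := by ring
          _ ≤ (r + 1) * (r + 2) * (m + (r + 1 + 1) + s) ^ r + (m + (s + (r + 1 + 1))) ^ (r + 1) :=
              Nat.add_le_add (Nat.mul_le_mul_left _ (hs _)) (ihn m (by omega))
          _ = (m + s + (r + 2)) ^ (r + 1) + (r + 1) * (r + 2) * (m + s + (r + 2)) ^ r := by ring
          _ ≤ (m + s + (r + 2) + (r + 2)) ^ (r + 1) := pow_succ_add_le_add_pow _ _ _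
          _ = _ := by ring

end IsNorm

open Filter in
theorem tendsto_add_natCast_div_pow (s r : ℕ) :
    Tendsto (fun n : ℕ => ((n + s : ℝ) / n) ^ r) atTop (nhds 1) := by
  have h : Tendsto (fun n : ℕ => 1 + (s : ℝ) / n) atTop (nhds 1) := by
    simpa using (tendsto_const_div_atTop_nhds_zero_nat (s : ℝ)).const_add 1
  have h' : Tendsto (fun n : ℕ => (n + s : ℝ) / n) atTop (nhds 1) := by
    refine h.congr' ?_
    filter_upwards [eventually_gt_atTop 0] with n hn
    have : (n : ℝ) ≠ 0 := by positivity
    field_simp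
  simpa using h'.pow r

open Filter in
/-- `c_{ω^{r+1}}(n) ~ n^r / (r! · (r+1)!)` as `n → ∞`: the number of partitions of `n`
into parts of size at most `r+1` is asymptotically `n^r / (r! · ∏_{i=1}^{r+1} i)`. -/
theorem count_below_omega_pow_succ_asymptotic (N : Ordinal → ℕ) (hN : IsNorm N) (r : ℕ) :
    Tendsto
      (fun n : ℕ =>
        (({α : Ordinal | α < omega0 ^ ((r : Ordinal) + 1) ∧ N α = n}.ncard : ℝ)) /
          ((n : ℝ) ^ r / ((r.factorial : ℝ) * ((r + 1).factorial : ℝ))))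
      atTop (nhds 1) := by
  obtain ⟨s, hs⟩ := hN.exists_mul_ncard_normLevel_le r
  have hset (n : ℕ) : {α : Ordinal | α < omega0 ^ ((r : Ordinal) + 1) ∧ N α = n} =
      normLevel N (r + 1) n := by
    simp [normLevel]
  simp only [hset]
  refine tendsto_of_tendsto_of_tendsto_of_le_of_le' tendsto_const_nhds
    (tendsto_add_natCast_div_pow s r) ?_ ?_ <;>
    filter_upwards [eventually_gt_atTop 0] with n hn
  · have h : (n : ℝ) ^ r ≤ r.factorial * (r + 1).factorial * (normLevel N (r + 1) n).ncard :=
      mod_cast hN.pow_le_mul_ncard_normLevel r n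
    rw [one_le_div (by positivity), div_le_iff₀ (by positivity)]
    linarith
  · have h : (r.factorial * (r + 1).factorial * (normLevel N (r + 1) n).ncard : ℝ) ≤
        (n + s : ℝ) ^ r := mod_cast hs n
    rw [div_pow, div_div_eq_mul_div]
    gcongr
    linarith
end

section
/- Let ω^ω ≤ β = ω^γ < ε₀ and let L = {ω^{r+1}·α₀ + ω^r·(b_r·l_r) + ⋯ + ω^0·(b_0·l_0) : α₀ < β, l_i ∈ ℕ} where b_i = 0 for some i ≤ r. Then lim_{n→∞} D_L(n) = 0. -/
open Ordinal

/-- The ordinal `ω^r · k r + ω^{r-1} · k (r-1) + ⋯ + ω^0 · k 0` (terms in decreasing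
order of exponents). -/
noncomputable def ordOf (r : ℕ) (k : ℕ → ℕ) : Ordinal :=
  ((List.range (r + 1)).reverse.map fun i : ℕ => omega0 ^ (i : Ordinal) * ((k i : ℕ) : Ordinal)).foldr
    (· + ·) 0

open Finset in
/-- If the terms of `p` are eventually negligible compared to its partial sums, then
`m ↦ ∑ d ∣ m, d * p d` has the same property. -/
theorem eventually_mul_sum_divisors_le_sum (p : ℕ → ℕ) (hp0 : p 0 = 0) (hp1 : 1 ≤ p 1)
    (hp : ∀ K, ∃ n₀, ∀ n ≥ n₀, K * p n ≤ ∑ k ∈ range (n + 1), p k) (K : ℕ) :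
    ∃ n₀, ∀ n ≥ n₀, K * ∑ d ∈ n.divisors, d * p d ≤
      ∑ k ∈ range (n + 1), ∑ d ∈ k.divisors, d * p d := by
  rcases Nat.eq_zero_or_pos K with rfl | hK
  · exact ⟨0, by simp⟩
  set M := 6 * K with hM
  obtain ⟨D₀, hD₀⟩ := hp (M * M)
  set B := ∑ d ∈ range D₀, d * p d with hB
  refine ⟨M * B + 1, fun m hm => ?_⟩
  set Q := ∑ k ∈ range (m + 1), p k with hQ
  set R := ∑ d ∈ m.divisors, d * p d with hR
  set S := ∑ k ∈ range (m + 1), ∑ d ∈ k.divisors, d * p d with hS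
  have hm1 : 1 ≤ m := by omega
  have hQ1 : 1 ≤ Q := hp1.trans
    (single_le_sum (f := p) (fun _ _ => Nat.zero_le _) (mem_range.2 (by omega : 1 < m + 1)))
  have hQ_Ioc : Q = ∑ d ∈ Ioc 0 m, p d := by
    rw [hQ, sum_range_succ', hp0, show Ioc 0 m = Ico (0 + 1) (m + 1) by ext; simp; omega,
      ← sum_Ico_add', ← range_eq_Ico, add_zero]
  have h_div : m.divisors ⊆ Ioc 0 m := fun d hd => mem_Ioc.2
    ⟨Nat.pos_of_mem_divisors hd, Nat.divisor_le hd⟩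
  have lower : m * Q ≤ 2 * S := by
    have h1 : S = ∑ d ∈ Ioc 0 m, (m / d) * (d * p d) := by
      have : ∀ d ∈ Ioc 0 m, (m / d) * (d * p d) =
          ∑ k ∈ Ioc 0 m, if d ∣ k then d * p d else 0 := by
        intro d _
        rw [← sum_filter, sum_const, Nat.Ioc_filter_dvd_card_eq_div, _root_.smul_eq_mul]
      rw [sum_congr rfl this, sum_comm, hS, sum_range_succ']
      simp only [Nat.divisors_zero, sum_empty, add_zero]
      rw [show Ioc 0 m = Ico (0 + 1) (m + 1) by ext; simp; omega, ← sum_Ico_add', ← range_eq_Ico]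
      refine sum_congr rfl fun k hk => ?_
      rw [← sum_filter]
      refine sum_congr ?_ fun _ _ => rfl
      ext d
      simp only [Nat.mem_divisors, mem_filter, mem_Ico, mem_range] at hk ⊢
      constructor
      · rintro ⟨h, _⟩
        exact ⟨⟨Nat.pos_of_dvd_of_pos h (by omega),
          by have := Nat.le_of_dvd (by omega) h; omega⟩, h⟩
      · rintro ⟨_, h⟩
        exact ⟨h, by omega⟩
    rw [h1, hQ_Ioc, mul_sum, mul_sum]
    refine sum_le_sum fun d hd => ?_
    rw [mem_Ioc] at hd
    have h3 : m ≤ 2 * ((m / d) * d) := by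
      have := Nat.div_add_mod m d
      have := Nat.mod_lt m hd.1
      have : d ≤ (m / d) * d := Nat.le_mul_of_pos_left _ (Nat.div_pos hd.2 hd.1)
      nlinarith
    calc m * p d ≤ (2 * ((m / d) * d)) * p d := by gcongr
      _ = 2 * (m / d * (d * p d)) := by ring
  have upper_term : ∀ d ∈ m.divisors, M * M * (d * p d) ≤ M * (m * p d) +
      (if m / d < M then m * Q else 0) + (if d < D₀ then M * M * (d * p d) else 0) := by
    intro d hd
    by_cases h1 : d < D₀
    · simp [h1]
    by_cases h2 : m / d < M
    · have h3 := hD₀ d (by omega)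
      have h4 : ∑ k ∈ range (d + 1), p k ≤ Q :=
        sum_le_sum_of_subset (range_mono (by have := Nat.divisor_le hd; omega))
      simp only [h2, if_true, h1, if_false]
      calc M * M * (d * p d) = d * (M * M * p d) := by ring
        _ ≤ m * Q := Nat.mul_le_mul (Nat.divisor_le hd) (h3.trans h4)
        _ ≤ _ := by omega
    · have h3 : M * d ≤ m := by
        rw [← Nat.div_mul_cancel (Nat.dvd_of_mem_divisors hd)]
        gcongr
        omega
      simp only [h2, h1, if_false]
      calc M * M * (d * p d) = M * ((M * d) * p d) := by ring
        _ ≤ M * (m * p d) := by gcongr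
        _ ≤ _ := by omega
  have upper : M * M * R ≤ M * (m * Q) + M * (m * Q) + M * M * B := by
    rw [hR, mul_sum]
    refine (sum_le_sum upper_term).trans ?_
    rw [sum_add_distrib, sum_add_distrib]
    gcongr
    · rw [← mul_sum, ← mul_sum, hQ_Ioc]
      gcongr
    · rw [← sum_filter, sum_const, _root_.smul_eq_mul]
      gcongr
      rw [← card_range M]
      refine card_le_card_of_injOn (fun d => m / d) (fun d hd => ?_) fun d hd e he h => ?_
      · simp only [coe_filter, Set.mem_ofPred_eq] at hd
        simpa using hd.2
      · simp only [coe_filter, Set.mem_ofPred_eq] at hd he h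
        have h1 := Nat.div_mul_cancel (Nat.dvd_of_mem_divisors hd.1)
        have h2 := Nat.div_mul_cancel (Nat.dvd_of_mem_divisors he.1)
        rw [← h, ← h1] at h2
        have : 0 < m / d := Nat.div_pos (Nat.divisor_le hd.1) (Nat.pos_of_mem_divisors hd.1)
        rw [h1] at h2
        exact (Nat.eq_of_mul_eq_mul_left this (h2.trans h1.symm)).symm
    · rw [← sum_filter, hB, mul_sum]
      refine sum_le_sum_of_subset fun d hd => ?_
      simpa using (mem_filter.1 hd).2
  have hBm : M * B ≤ m * Q := by nlinarith
  have h6 : M * (M * R) ≤ M * (6 * S) := by nlinarith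
  have h7 : M * R ≤ 6 * S := Nat.le_of_mul_le_mul_left h6 (by omega)
  rw [hM, mul_assoc] at h7
  omega

open Finset in
/-- If `c` is the sequence of partial sums of `a` and both satisfy the convolution (in)equalities
typical of counting functions of multisets, with `R` negligible compared to its partial sums,
then `a` is negligible compared to `c`. -/
theorem eventually_mul_le_of_convolution (a c R : ℕ → ℕ)
    (hc : ∀ n, c n = ∑ k ∈ range (n + 1), a k)
    (ha' : ∀ n, n * a n ≤ ∑ m ∈ range (n + 1), R m * a (n - m))
    (hc' : ∀ n, n * c n = ∑ m ∈ range (n + 1), R m * c (n - m))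
    (hR : ∀ K, ∃ n₀, ∀ n ≥ n₀, K * R n ≤ ∑ k ∈ range (n + 1), R k) (K : ℕ) :
    ∃ n₀, ∀ n ≥ n₀, K * a n ≤ c n := by
  obtain ⟨m₀, hm₀⟩ := hR (2 * K)
  set B := ∑ m ∈ range m₀, R m with hB
  refine ⟨2 * K * B + 1, fun n hn => ?_⟩
  have sum_S : n * c n = ∑ m ∈ range (n + 1), (∑ k ∈ range (m + 1), R k) * a (n - m) := by
    rw [hc']
    simp only [hc, mul_sum, sum_mul]
    rw [sum_sigma', sum_sigma']
    refine sum_nbij' (fun x => ⟨n - x.2, x.1⟩) (fun x => ⟨x.2, n - x.1⟩) ?_ ?_ ?_ ?_ ?_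
    · rintro ⟨m, k⟩ h
      simp only [mem_sigma, mem_range] at h ⊢
      omega
    · rintro ⟨m, k⟩ h
      simp only [mem_sigma, mem_range] at h ⊢
      omega
    · rintro ⟨m, k⟩ h
      simp only [mem_sigma, mem_range] at h
      simp only [Sigma.mk.injEq, heq_eq_eq, true_and]
      omega
    · rintro ⟨m, k⟩ h
      simp only [mem_sigma, mem_range] at h
      simp only [Sigma.mk.injEq, heq_eq_eq, and_true]
      omega
    · rintro ⟨m, k⟩ h
      simp only [mem_sigma, mem_range] at h
      simp only
      congr 2
      omega
  have hKR : ∀ m, 2 * K * R m ≤ (∑ k ∈ range (m + 1), R k) + 2 * K * B := by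
    intro m
    by_cases h : m₀ ≤ m
    · exact (hm₀ m h).trans (Nat.le_add_right _ _)
    · have : R m ≤ B := single_le_sum (f := R) (fun _ _ => Nat.zero_le _) (by simpa using h)
      calc 2 * K * R m ≤ 2 * K * B := by gcongr
        _ ≤ _ := Nat.le_add_left _ _
  have key : 2 * K * (n * a n) ≤ n * c n + 2 * K * B * c n := by
    calc 2 * K * (n * a n) ≤ 2 * K * ∑ m ∈ range (n + 1), R m * a (n - m) := by
          gcongr
          exact ha' n
      _ = ∑ m ∈ range (n + 1), (2 * K * R m) * a (n - m) := by
          rw [mul_sum]; exact sum_congr rfl fun _ _ => by ring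
      _ ≤ ∑ m ∈ range (n + 1), ((∑ k ∈ range (m + 1), R k) + 2 * K * B) * a (n - m) := by
          gcongr with m _
          exact hKR m
      _ = n * c n + 2 * K * B * c n := by
          simp only [add_mul, sum_add_distrib]
          rw [← sum_S, ← mul_sum, hc, ← sum_range_reflect a]
          simp
  have h8 : (2 * n) * (K * a n) ≤ (2 * n) * c n := by nlinarith
  exact Nat.le_of_mul_le_mul_left h8 (by omega)

/-- If the increments `a` of `c` are negligible compared to `c`, then `c` varies slowly. -/
theorem eventually_mul_le_mul_sub_add (a c : ℕ → ℕ) (step : ∀ n, c (n + 1) = a (n + 1) + c n)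
    (h₀ : ∀ K, ∃ n₀, ∀ n ≥ n₀, K * a n ≤ c n) (K d : ℕ) :
    ∃ n₀, ∀ n ≥ n₀, K * c n ≤ K * c (n - d) + d * c n := by
  have mono : Monotone c := monotone_nat_of_le_succ fun n => by rw [step]; omega
  obtain ⟨n₀, hn₀⟩ := h₀ K
  refine ⟨n₀ + d, ?_⟩
  induction d with
  | zero => simp
  | succ d ih =>
    intro n hn
    obtain ⟨m, hm⟩ : ∃ m, n - d = m + 1 := ⟨n - d - 1, by omega⟩
    have h1 := ih n (by omega)
    have h2 := hn₀ (m + 1) (by omega)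
    have h3 := step m
    have h4 : c (m + 1) ≤ c n := mono (by omega)
    rw [show n - (d + 1) = m by omega]
    rw [hm] at h1
    nlinarith

open Finset in
/-- If the increments `a` of `c` are negligible compared to `c`, then `c` is negligible compared
to its partial sums. -/
theorem eventually_mul_le_sum (a c : ℕ → ℕ) (step : ∀ n, c (n + 1) = a (n + 1) + c n)
    (h₀ : ∀ K, ∃ n₀, ∀ n ≥ n₀, K * a n ≤ c n) (K : ℕ) :
    ∃ n₀, ∀ n ≥ n₀, K * c n ≤ ∑ k ∈ range (n + 1), c k := by
  have mono : Monotone c := monotone_nat_of_le_succ fun n => by rw [step]; omega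
  rcases Nat.eq_zero_or_pos K with rfl | hK
  · exact ⟨0, by simp⟩
  obtain ⟨n₀, hn₀⟩ := eventually_mul_le_mul_sub_add a c step h₀ (2 * (2 * K)) (2 * K)
  refine ⟨n₀ + 2 * K, fun n hn => ?_⟩
  have h1 := hn₀ n (by omega)
  have h2 : c n ≤ 2 * c (n - 2 * K) := by
    refine Nat.le_of_mul_le_mul_left (?_ : 2 * K * c n ≤ 2 * K * (2 * c (n - 2 * K))) (by omega)
    nlinarith
  calc K * c n ≤ 2 * K * c (n - 2 * K) := by nlinarith
    _ ≤ ∑ k ∈ Ico (n + 1 - 2 * K) (n + 1), c k := by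
      have h3 : #(Ico (n + 1 - 2 * K) (n + 1)) = 2 * K := by rw [Nat.card_Ico]; omega
      have := card_nsmul_le_sum (Ico (n + 1 - 2 * K) (n + 1)) c (c (n - 2 * K))
        fun k hk => mono (by rw [mem_Ico] at hk; omega)
      rwa [h3, _root_.smul_eq_mul] at this
    _ ≤ _ := sum_le_sum_of_subset fun k hk => by rw [mem_Ico] at hk; rw [mem_range]; omega

/-- Multisets with elements in `T` and total weight `n`. -/
def multisetsOfWeight {ι : Type*} (w : ι → ℕ) (T : Set ι) (n : ℕ) : Set (Multiset ι) :=
  {s | (∀ e ∈ s, e ∈ T) ∧ (s.map w).sum = n}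

section MultisetsOfWeight

variable {ι : Type*} {w : ι → ℕ} {T : Set ι}

theorem finite_multisetsOfWeight (hw : ∀ e, 1 ≤ w e) (hT : ∀ n, {e ∈ T | w e = n}.Finite) (n : ℕ) :
    (multisetsOfWeight w T n).Finite := by
  induction n using Nat.strong_induction_on with
  | _ n ih =>
    refine ((Set.finite_singleton (0 : Multiset ι)).union
      ((Set.finite_lt_nat n).biUnion fun k hk => ((hT (n - k)).image2
        (fun e s => e ::ₘ s) (ih k hk)))).subset ?_
    rintro s ⟨hs, rfl⟩
    induction s using Multiset.induction_on with
    | empty => exact Or.inl rfl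
    | cons e t _ =>
      have := hw e
      simp only [Multiset.map_cons, Multiset.sum_cons]
      refine Or.inr (Set.mem_biUnion (x := (t.map w).sum) ?_ ?_)
      · simp only [Set.mem_ofPred_eq]
        omega
      · refine Set.mem_image2_of_mem ⟨hs e (Multiset.mem_cons_self e t), by omega⟩
          ⟨fun x hx => hs x (Multiset.mem_cons_of_mem hx), rfl⟩

theorem ncard_multisetsOfWeight_le_count [DecidableEq ι] {e : ι} (he : e ∈ T) (j n : ℕ)
    (hj : j * w e ≤ n) :
    {s ∈ multisetsOfWeight w T n | j ≤ s.count e}.ncard =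
      (multisetsOfWeight w T (n - j * w e)).ncard := by
  have : {s ∈ multisetsOfWeight w T n | j ≤ s.count e} =
      (fun t => Multiset.replicate j e + t) '' multisetsOfWeight w T (n - j * w e) := by
    ext s
    constructor
    · rintro ⟨⟨hs, hn⟩, h⟩
      rw [Multiset.le_count_iff_replicate_le] at h
      obtain ⟨t, rfl⟩ := Multiset.le_iff_exists_add.1 h
      refine ⟨t, ⟨fun x hx => hs x (Multiset.mem_add.2 (Or.inr hx)), ?_⟩, rfl⟩
      simp at hn
      omega
    · rintro ⟨t, ⟨hs, hn⟩, rfl⟩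
      refine ⟨⟨fun x hx => ?_, ?_⟩, ?_⟩
      · rcases Multiset.mem_add.1 hx with h | h
        · rwa [Multiset.eq_of_mem_replicate h]
        · exact hs x h
      · simp
        omega
      · simp
  rw [this, Set.ncard_image_of_injective _ (add_right_injective _)]

/-- Removing one copy of `e` is a bijection from the multisets containing `e`. -/
theorem ncard_multisetsOfWeight_eq_add (hw : ∀ e, 1 ≤ w e) (hT : ∀ n, {e ∈ T | w e = n}.Finite)
    {e : ι} (he : e ∈ T) {n : ℕ} (hn : w e ≤ n) :
    (multisetsOfWeight w T n).ncard = (multisetsOfWeight w (T \ {e}) n).ncard +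
      (multisetsOfWeight w T (n - w e)).ncard := by
  classical
  have h1 := ncard_multisetsOfWeight_le_count (w := w) he 1 n (by simpa using hn)
  rw [one_mul] at h1
  rw [← h1, ← Set.ncard_union_eq ?_ ?_ ?_]
  · congr 1
    ext s
    simp only [multisetsOfWeight, Set.mem_union, Set.mem_ofPred_eq, Set.mem_sdiff,
      Set.mem_singleton_iff, Multiset.one_le_count_iff_mem]
    by_cases h : e ∈ s
    · simp only [h, and_true, iff_or_self, and_imp]
      exact fun h' _ => absurd rfl (h' e h).2
    · simp only [h, and_false, or_false, and_congr_left_iff]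
      exact fun _ => ⟨fun h' x hx => ⟨h' x hx, fun hxe => h (hxe ▸ hx)⟩, fun h' x hx => (h' x hx).1⟩
  · rw [Set.disjoint_left]
    rintro s ⟨hs, _⟩ ⟨_, h⟩
    exact (hs e (Multiset.one_le_count_iff_mem.1 h)).2 rfl
  · refine (finite_multisetsOfWeight hw hT n).subset ?_
    rintro s ⟨hs, h⟩
    exact ⟨fun x hx => (hs x hx).1, h⟩
  · exact (finite_multisetsOfWeight hw hT n).subset fun s hs => hs.1

theorem ncard_multisetsOfWeight_diff_of_lt {e : ι} {n : ℕ} (hn : n < w e) :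
    (multisetsOfWeight w (T \ {e}) n).ncard = (multisetsOfWeight w T n).ncard := by
  congr 1
  ext s
  simp only [multisetsOfWeight, Set.mem_ofPred_eq, Set.mem_sdiff, Set.mem_singleton_iff]
  constructor
  · exact fun h => ⟨fun x hx => (h.1 x hx).1, h.2⟩
  · refine fun h => ⟨fun x hx => ⟨h.1 x hx, ?_⟩, h.2⟩
    rintro rfl
    have := Multiset.single_le_sum (fun _ _ => Nat.zero_le _) _ (Multiset.mem_map_of_mem w hx)
    omega

open Finset in
/-- Double counting of the pairs (multiset of weight `n`, element counted with multiplicity). -/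
theorem mul_ncard_multisetsOfWeight (hw : ∀ e, 1 ≤ w e) (hT : ∀ n, {e ∈ T | w e = n}.Finite)
    (n : ℕ) :
    n * (multisetsOfWeight w T n).ncard = ∑ m ∈ range (n + 1),
      (∑ d ∈ m.divisors, d * {e ∈ T | w e = d}.ncard) * (multisetsOfWeight w T (n - m)).ncard := by
  classical
  have hX := finite_multisetsOfWeight hw hT n
  have hF : {e ∈ T | w e ≤ n}.Finite := by
    refine ((Set.finite_le_nat n).biUnion fun k _ => hT k).subset ?_
    exact fun e he => Set.mem_biUnion (x := w e) he.2 ⟨he.1, rfl⟩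
  set X := hX.toFinset with hXdef
  set F := hF.toFinset with hFdef
  have mem_X : ∀ {s}, s ∈ X ↔ s ∈ multisetsOfWeight w T n := by simp [hXdef]
  have mem_F : ∀ {e}, e ∈ F ↔ e ∈ T ∧ w e ≤ n := by simp [hFdef]
  have weight_le : ∀ s ∈ X, ∀ e, w e * s.count e ≤ n := by
    intro s hs e
    have h := (mem_X.1 hs).2
    have h1 : Multiset.replicate (s.count e) e ≤ s := Multiset.le_count_iff_replicate_le.1 le_rfl
    obtain ⟨t, ht⟩ := Multiset.le_iff_exists_add.1 h1
    rw [ht] at h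
    simp only [Multiset.map_add, Multiset.map_replicate, Multiset.sum_add,
      Multiset.sum_replicate, _root_.smul_eq_mul] at h
    rw [mul_comm]
    omega
  have weight_eq : ∀ s ∈ X, n = ∑ e ∈ F, w e * s.count e := by
    intro s hs
    have h := (mem_X.1 hs).2
    rw [Finset.sum_multiset_map_count] at h
    rw [← h]
    simp only [_root_.smul_eq_mul]
    rw [sum_subset (s₂ := F)]
    · exact sum_congr rfl fun _ _ => mul_comm _ _
    · intro e he
      rw [Multiset.mem_toFinset] at he
      refine mem_F.2 ⟨(mem_X.1 hs).1 e he, ?_⟩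
      have := weight_le s hs e
      have := Multiset.count_pos.2 he
      nlinarith
    · intro e _ he
      rw [Multiset.mem_toFinset] at he
      simp [he]
  have count_eq : ∀ s ∈ X, ∀ e, s.count e =
      ∑ m ∈ Ioc 0 n with w e ∣ m, if m / w e ≤ s.count e then 1 else 0 := by
    intro s hs e
    have h := Nat.Ioc_filter_dvd_card_eq_div (w e * s.count e) (w e)
    rw [Nat.mul_div_cancel_left _ (hw e)] at h
    rw [← card_filter, filter_filter]
    refine h.symm.trans ?_
    have := weight_le s hs e
    congr 1
    ext m
    simp only [mem_filter, mem_Ioc]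
    constructor
    · rintro ⟨⟨h0, h1⟩, h2⟩
      exact ⟨⟨h0, by omega⟩, h2, Nat.div_le_of_le_mul h1⟩
    · rintro ⟨⟨h0, h1⟩, h2, h3⟩
      refine ⟨⟨h0, ?_⟩, h2⟩
      rw [← Nat.mul_div_cancel' h2]
      gcongr
  have card_X : ∀ e ∈ F, ∀ m ∈ Ioc 0 n, w e ∣ m →
      ∑ s ∈ X, (if m / w e ≤ s.count e then 1 else 0) =
        (multisetsOfWeight w T (n - m)).ncard := by
    intro e he m hm hdvd
    have h := ncard_multisetsOfWeight_le_count (w := w) (mem_F.1 he).1 (m / w e) n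
      (by rw [Nat.div_mul_cancel hdvd]; exact (mem_Ioc.1 hm).2)
    rw [Nat.div_mul_cancel hdvd] at h
    rw [← h, ← card_filter, ← Set.ncard_coe_finset]
    congr 1
    ext s
    simp [mem_X]
  have card_F : ∀ m ∈ Ioc 0 n, ∑ e ∈ F with w e ∣ m, w e =
      ∑ d ∈ m.divisors, d * {e ∈ T | w e = d}.ncard := by
    intro m hm
    rw [mem_Ioc] at hm
    rw [← sum_fiberwise_of_maps_to (t := m.divisors) (g := w)]
    · refine sum_congr rfl fun d hd => ?_
      rw [sum_congr rfl (g := fun _ => d) fun e he => (mem_filter.1 he).2, sum_const,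
        _root_.smul_eq_mul, mul_comm, ← Set.ncard_coe_finset]
      congr 2
      ext e
      have := Nat.divisor_le hd
      simp only [coe_filter, mem_filter, mem_F, Set.mem_ofPred_eq]
      constructor
      · rintro ⟨⟨⟨h, _⟩, _⟩, h'⟩
        exact ⟨h, h'⟩
      · rintro ⟨h, rfl⟩
        exact ⟨⟨⟨h, by omega⟩, Nat.dvd_of_mem_divisors hd⟩, rfl⟩
    · intro e he
      exact Nat.mem_divisors.2 ⟨(mem_filter.1 he).2, by omega⟩
  calc n * (multisetsOfWeight w T n).ncard = ∑ s ∈ X, n := by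
        rw [Set.ncard_eq_toFinset_card _ hX, sum_const, _root_.smul_eq_mul, mul_comm]
    _ = ∑ s ∈ X, ∑ e ∈ F, ∑ m ∈ Ioc 0 n with w e ∣ m,
          w e * if m / w e ≤ s.count e then 1 else 0 := by
        refine sum_congr rfl fun s hs => ?_
        rw [weight_eq s hs]
        refine sum_congr rfl fun e _ => ?_
        rw [← weight_eq s hs, ← mul_sum, ← count_eq s hs]
    _ = ∑ e ∈ F, ∑ m ∈ Ioc 0 n with w e ∣ m,
          w e * (multisetsOfWeight w T (n - m)).ncard := by
        rw [sum_comm]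
        refine sum_congr rfl fun e he => ?_
        rw [sum_comm]
        refine sum_congr rfl fun m hm => ?_
        rw [mem_filter] at hm
        rw [← mul_sum, card_X e he m hm.1 hm.2]
    _ = ∑ m ∈ Ioc 0 n, (∑ e ∈ F with w e ∣ m, w e) *
          (multisetsOfWeight w T (n - m)).ncard := by
        simp only [sum_filter, sum_mul, ite_mul, zero_mul]
        exact sum_comm
    _ = ∑ m ∈ Ioc 0 n, (∑ d ∈ m.divisors, d * {e ∈ T | w e = d}.ncard) *
          (multisetsOfWeight w T (n - m)).ncard :=
        sum_congr rfl fun m hm => by rw [card_F m hm]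
    _ = _ := by
        refine sum_subset (fun m hm => ?_) fun m hm hm' => ?_
        · simp only [mem_Ioc, mem_range] at hm ⊢
          omega
        · obtain rfl : m = 0 := by
            simp only [mem_Ioc, mem_range] at hm hm'
            omega
          simp

open Finset in
/-- If the number of parts of weight `n` is negligible compared to the number of parts of weight
at most `n`, then almost every multiset contains any given part `e₀` of weight one. -/
theorem eventually_mul_ncard_diff_le (hw : ∀ e, 1 ≤ w e) (hT : ∀ n, {e ∈ T | w e = n}.Finite)
    {e₀ : ι} (he₀ : e₀ ∈ T) (hwe₀ : w e₀ = 1)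
    (hp : ∀ K, ∃ n₀, ∀ n ≥ n₀,
      K * {e ∈ T | w e = n}.ncard ≤ ∑ k ∈ range (n + 1), {e ∈ T | w e = k}.ncard) (K : ℕ) :
    ∃ n₀, ∀ n ≥ n₀,
      K * (multisetsOfWeight w (T \ {e₀}) n).ncard ≤ (multisetsOfWeight w T n).ncard := by
  have hT' : ∀ n, {e ∈ T \ {e₀} | w e = n}.Finite := fun n =>
    (hT n).subset fun e he => ⟨he.1.1, he.2⟩
  refine eventually_mul_le_of_convolution _ _
    (fun m => ∑ d ∈ m.divisors, d * {e ∈ T | w e = d}.ncard) ?_ ?_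
    (mul_ncard_multisetsOfWeight hw hT) ?_ K
  · intro n
    induction n with
    | zero => simp [ncard_multisetsOfWeight_diff_of_lt (T := T) (w := w) (e := e₀) (n := 0)
        (by omega)]
    | succ n ih =>
      rw [ncard_multisetsOfWeight_eq_add hw hT he₀ (by omega), hwe₀, sum_range_succ,
        Nat.add_sub_cancel, ih, add_comm]
  · intro n
    rw [mul_ncard_multisetsOfWeight hw hT']
    gcongr with m _ d _
    · exact hT d
    · exact Set.sdiff_subset
  · refine eventually_mul_sum_divisors_le_sum (fun d => {e ∈ T | w e = d}.ncard) ?_ ?_ hp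
    · have : {e ∈ T | w e = 0} = ∅ := by
        ext e
        have := hw e
        simp only [Set.mem_ofPred_eq, Set.mem_empty_iff_false, iff_false]
        omega
      simp [this]
    · exact (Set.ncard_pos (hT 1)).2 ⟨e₀, he₀, hwe₀⟩

/-- If almost every multiset contains a part of weight one, then almost every multiset contains
any given part. -/
theorem eventually_mul_ncard_diff_le_of_weight_one (hw : ∀ e, 1 ≤ w e)
    (hT : ∀ n, {e ∈ T | w e = n}.Finite) {e₀ : ι} (he₀ : e₀ ∈ T) (hwe₀ : w e₀ = 1)
    (h₀ : ∀ K, ∃ n₀, ∀ n ≥ n₀,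
      K * (multisetsOfWeight w (T \ {e₀}) n).ncard ≤ (multisetsOfWeight w T n).ncard)
    {e : ι} (he : e ∈ T) (K : ℕ) :
    ∃ n₀, ∀ n ≥ n₀,
      K * (multisetsOfWeight w (T \ {e}) n).ncard ≤ (multisetsOfWeight w T n).ncard := by
  set c := fun n => (multisetsOfWeight w T n).ncard with hc
  have step : ∀ n, c (n + 1) = (multisetsOfWeight w (T \ {e₀}) (n + 1)).ncard + c n := by
    intro n
    have h := ncard_multisetsOfWeight_eq_add hw hT he₀ (n := n + 1) (by omega)
    rwa [hwe₀, Nat.add_sub_cancel] at h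
  obtain ⟨n₀, hn₀⟩ := eventually_mul_le_mul_sub_add _ c step h₀ (K * w e) (w e)
  refine ⟨n₀ + w e, fun n hn => ?_⟩
  have h1 := hn₀ n (by omega)
  have h2 := ncard_multisetsOfWeight_eq_add hw hT he (n := n) (by omega)
  have h3 := hw e
  change c n = _ + c (n - w e) at h2
  refine Nat.le_of_mul_le_mul_left ?_ h3
  change _ ≤ w e * c n
  rw [h2] at h1 ⊢
  nlinarith

end MultisetsOfWeight

/-- The ordinal with the given list of exponents, `ω ^ e₁ + (ω ^ e₂ + ⋯)`. -/
noncomputable def ordOfExponents (l : List Ordinal) : Ordinal :=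
  l.foldr (fun e a => omega0 ^ e + a) 0

@[simp]
theorem ordOfExponents_nil : ordOfExponents [] = 0 := rfl

@[simp]
theorem ordOfExponents_cons (e : Ordinal) (l : List Ordinal) :
    ordOfExponents (e :: l) = omega0 ^ e + ordOfExponents l := rfl

theorem ordOfExponents_append (l₁ l₂ : List Ordinal) :
    ordOfExponents (l₁ ++ l₂) = ordOfExponents l₁ + ordOfExponents l₂ := by
  induction l₁ with
  | nil => simp
  | cons e l ih => simp [ih, add_assoc]

theorem ordOfExponents_replicate (k : ℕ) (e : Ordinal) :
    ordOfExponents (List.replicate k e) = omega0 ^ e * k := by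
  induction k with
  | zero => simp
  | succ k ih =>
    rw [List.replicate_succ, ordOfExponents_cons, ih, add_comm k 1, Nat.cast_add, Nat.cast_one,
      mul_add, mul_one]

theorem ordOfExponents_map_add (e : Ordinal) (l : List Ordinal) :
    ordOfExponents (l.map (e + ·)) = omega0 ^ e * ordOfExponents l := by
  induction l with
  | nil => simp
  | cons x l ih => simp [ih, mul_add, opow_add]

theorem ordOfExponents_lt_omega0_opow {l : List Ordinal} {γ : Ordinal} (h : ∀ e ∈ l, e < γ) :
    ordOfExponents l < omega0 ^ γ := by
  induction l with
  | nil => exact opow_pos _ omega0_pos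
  | cons e l ih =>
    simp only [List.mem_cons, forall_eq_or_imp] at h
    exact isPrincipal_add_omega0_opow γ ((opow_lt_opow_iff_right one_lt_omega0).2 h.1) (ih h.2)

theorem omega0_opow_le_ordOfExponents {l : List Ordinal} {e : Ordinal} (h : e ∈ l) :
    omega0 ^ e ≤ ordOfExponents l := by
  induction l with
  | nil => simp at h
  | cons x l ih =>
    rw [ordOfExponents_cons]
    rcases List.mem_cons.1 h with rfl | h
    · exact le_self_add
    · exact (ih h).trans le_add_self

theorem lt_of_mem_of_ordOfExponents_lt {l : List Ordinal} {e γ : Ordinal} (h : e ∈ l)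
    (hl : ordOfExponents l < omega0 ^ γ) : e < γ :=
  (opow_lt_opow_iff_right one_lt_omega0).1 ((omega0_opow_le_ordOfExponents h).trans_lt hl)

theorem ordOfExponents_lt_of_pairwise {e : Ordinal} {l : List Ordinal}
    (h : (e :: l).Pairwise (· ≥ ·)) : ordOfExponents l < omega0 ^ (e + 1) :=
  ordOfExponents_lt_omega0_opow fun x hx => by
    rw [← Order.succ_eq_add_one, Order.lt_succ_iff]
    exact (List.pairwise_cons.1 h).1 x hx

theorem ordOfExponents_injective {l₁ l₂ : List Ordinal} (h₁ : l₁.Pairwise (· ≥ ·))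
    (h₂ : l₂.Pairwise (· ≥ ·)) (h : ordOfExponents l₁ = ordOfExponents l₂) : l₁ = l₂ := by
  induction l₁ generalizing l₂ with
  | nil =>
    cases l₂ with
    | nil => rfl
    | cons e l =>
      have := omega0_opow_le_ordOfExponents (List.mem_cons_self (a := e) (l := l))
      rw [← h, ordOfExponents_nil] at this
      exact absurd this (not_le.2 (opow_pos _ omega0_pos))
  | cons e l ih =>
    cases l₂ with
    | nil =>
      have := omega0_opow_le_ordOfExponents (List.mem_cons_self (a := e) (l := l))
      rw [h, ordOfExponents_nil] at this
      exact absurd this (not_le.2 (opow_pos _ omega0_pos))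
    | cons e' l' =>
      have key : ∀ {x y : Ordinal} {s t : List Ordinal}, (y :: t).Pairwise (· ≥ ·) →
          ordOfExponents (x :: s) = ordOfExponents (y :: t) → x ≤ y := by
        intro x y s t ht hst
        rw [← Order.lt_succ_iff, Order.succ_eq_add_one]
        refine lt_of_mem_of_ordOfExponents_lt (List.mem_cons_self (a := x) (l := s)) ?_
        rw [hst]
        refine ordOfExponents_lt_omega0_opow fun z hz => ?_
        rw [← Order.succ_eq_add_one, Order.lt_succ_iff]
        rcases List.mem_cons.1 hz with rfl | hz
        · exact le_rfl
        · exact (List.pairwise_cons.1 ht).1 z hz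
      obtain rfl := le_antisymm (key h₂ h) (key h₁ h.symm)
      rw [ordOfExponents_cons, ordOfExponents_cons, add_right_inj] at h
      rw [ih (List.pairwise_cons.1 h₁).2 (List.pairwise_cons.1 h₂).2 h]

/-- Splitting off the leading term of the Cantor normal form. -/
theorem exists_eq_omega0_opow_add {α : Ordinal} (hα : α ≠ 0) :
    ∃ e b : Ordinal, α = omega0 ^ e + b ∧ b < omega0 ^ (e + 1) ∧ b < α := by
  have h1 := opow_log_le_self omega0 hα
  have h2 := lt_opow_succ_log_self one_lt_omega0 α
  refine ⟨log omega0 α, α - omega0 ^ log omega0 α, (Ordinal.add_sub_cancel_of_le h1).symm,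
    ?_, ?_⟩
  · exact (Ordinal.sub_le_self _ _).trans_lt h2
  · refine (Ordinal.sub_le_self _ _).lt_of_ne fun h => ?_
    have h3 := Ordinal.add_sub_cancel_of_le h1
    rw [h, add_eq_right_iff_mul_omega0_le, ← opow_succ] at h3
    exact absurd h3 (not_le.2 h2)

theorem exists_ordOfExponents_eq (α : Ordinal) :
    ∃ l : List Ordinal, l.Pairwise (· ≥ ·) ∧ ordOfExponents l = α := by
  induction α using WellFoundedLT.induction with
  | ind α ih =>
    rcases eq_or_ne α 0 with rfl | hα
    · exact ⟨[], List.Pairwise.nil, rfl⟩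
    obtain ⟨e, b, rfl, hb, hlt⟩ := exists_eq_omega0_opow_add hα
    obtain ⟨l, hl, rfl⟩ := ih b hlt
    refine ⟨e :: l, List.pairwise_cons.2 ⟨fun x hx => ?_, hl⟩, rfl⟩
    have := lt_of_mem_of_ordOfExponents_lt hx hb
    rwa [← Order.succ_eq_add_one, Order.lt_succ_iff] at this

theorem exists_ordOfExponents_eq_ordOf (r : ℕ) (k : ℕ → ℕ) :
    ∃ l : List Ordinal, l.Pairwise (· ≥ ·) ∧ ordOfExponents l = ordOf r k ∧
      ∀ e ∈ l, ∃ j ≤ r, e = (j : Ordinal) ∧ k j ≠ 0 := by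
  have succ_eq : ∀ r, ordOf (r + 1) k =
      omega0 ^ ((r + 1 : ℕ) : Ordinal) * (k (r + 1) : Ordinal) + ordOf r k := by
    intro r
    simp [ordOf, List.range_succ, pow_succ]
  have replicate_mem : ∀ j, ∀ e ∈ List.replicate (k j) (j : Ordinal),
      e = (j : Ordinal) ∧ k j ≠ 0 := by
    intro j e he
    rw [List.mem_replicate] at he
    exact ⟨he.2, he.1⟩
  induction r with
  | zero =>
    refine ⟨List.replicate (k 0) ((0 : ℕ) : Ordinal), ?_, ?_, ?_⟩
    · exact List.pairwise_replicate.2 (Or.inr le_rfl)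
    · rw [ordOfExponents_replicate]
      simp [ordOf]
    · exact fun e he => ⟨0, le_rfl, replicate_mem 0 e he⟩
  | succ r ih =>
    obtain ⟨l, hl, hl', hmem⟩ := ih
    refine ⟨List.replicate (k (r + 1)) ((r + 1 : ℕ) : Ordinal) ++ l, ?_, ?_, ?_⟩
    · refine List.pairwise_append.2 ⟨List.pairwise_replicate.2 (Or.inr le_rfl), hl, ?_⟩
      intro x hx y hy
      obtain ⟨j, hj, rfl, _⟩ := hmem y hy
      rw [(replicate_mem _ x hx).1]
      exact Nat.cast_le.2 (by omega)
    · rw [ordOfExponents_append, ordOfExponents_replicate, succ_eq, hl']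
    · intro e he
      rcases List.mem_append.1 he with he | he
      · exact ⟨r + 1, le_rfl, replicate_mem _ e he⟩
      · obtain ⟨j, hj, h⟩ := hmem e he
        exact ⟨j, by omega, h⟩

theorem lt_omega0_opow_of_lt_eps0 {e : Ordinal} (he : e < eps0) : e < omega0 ^ e :=
  (right_le_opow e one_lt_omega0).lt_of_ne fun h =>
    notMem_of_lt_csInf he (OrderBot.bddBelow _) h.symm

namespace IsNorm

variable {N : Ordinal → ℕ}

theorem norm_ordOfExponents (hN : IsNorm N) {l : List Ordinal} (hl : l.Pairwise (· ≥ ·))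
    (hlt : ordOfExponents l < eps0) :
    N (ordOfExponents l) = (l.map fun e => 1 + N e).sum := by
  induction l with
  | nil => simpa using hN.1
  | cons e l ih =>
    rw [ordOfExponents_cons] at hlt ⊢
    rw [hN.2 e _ hlt (ordOfExponents_lt_of_pairwise hl),
      ih (List.pairwise_cons.1 hl).2 (le_add_self.trans_lt hlt)]
    simp

theorem finite_setOf_lt_eps0 (hN : IsNorm N) (n : ℕ) : {α | α < eps0 ∧ N α = n}.Finite := by
  induction n using Nat.strong_induction_on with
  | _ n ih =>
    have hfin : {α | α < eps0 ∧ N α < n}.Finite := by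
      refine ((Set.finite_lt_nat n).biUnion fun k hk => ih k hk).subset ?_
      exact fun α hα => Set.mem_biUnion (x := N α) hα.2 ⟨hα.1, rfl⟩
    refine ((Set.finite_singleton (0 : Ordinal)).union
      (hfin.image2 (fun e b => omega0 ^ e + b) hfin)).subset ?_
    rintro α ⟨hα, rfl⟩
    rcases eq_or_ne α 0 with rfl | h0
    · exact Or.inl rfl
    obtain ⟨e, b, rfl, hb, hlt⟩ := exists_eq_omega0_opow_add h0
    have h := hN.2 e b hα hb
    refine Or.inr (Set.mem_image2_of_mem ⟨?_, by omega⟩ ⟨hlt.trans hα, by omega⟩)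
    exact ((right_le_opow e one_lt_omega0).trans le_self_add).trans_lt hα

theorem finite_setOf_lt (hN : IsNorm N) {β : Ordinal} (hβ : β ≤ eps0) (n : ℕ) :
    {α | α < β ∧ N α = n}.Finite :=
  (hN.finite_setOf_lt_eps0 n).subset fun _ hα => ⟨hα.1.trans_le hβ, hα.2⟩

theorem finite_setOf_weight (hN : IsNorm N) {γ : Ordinal} (hγ : γ ≤ eps0) (n : ℕ) :
    {e ∈ Set.Iio γ | 1 + N e = n}.Finite :=
  (hN.finite_setOf_lt hγ (n - 1)).subset fun e he => ⟨he.1, by have := he.2; omega⟩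

/-- The ordinal whose Cantor normal form has the given multiset of exponents. -/
noncomputable def ofMultiset (s : Multiset Ordinal) : Ordinal :=
  ordOfExponents (s.sort (· ≥ ·))

theorem ofMultiset_injective : Function.Injective ofMultiset := fun s t h => by
  rw [← Multiset.sort_eq s (· ≥ ·), ← Multiset.sort_eq t (· ≥ ·),
    ordOfExponents_injective (Multiset.pairwise_sort s _) (Multiset.pairwise_sort t _) h]

theorem ofMultiset_coe {l : List Ordinal} (hl : l.Pairwise (· ≥ ·)) :
    ofMultiset (l : Multiset Ordinal) = ordOfExponents l := by
  have h : (l : Multiset Ordinal).sort (· ≥ ·) = l :=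
    List.Perm.eq_of_pairwise (fun _ _ _ _ h h' => le_antisymm h' h) (Multiset.pairwise_sort _ _) hl
      (Multiset.coe_eq_coe.1 (Multiset.sort_eq _ _))
  rw [ofMultiset, h]

theorem ofMultiset_image (hN : IsNorm N) {γ : Ordinal} (hγ : omega0 ^ γ ≤ eps0) (n : ℕ) :
    ofMultiset '' multisetsOfWeight (fun e => 1 + N e) (Set.Iio γ) n =
      {α | α < omega0 ^ γ ∧ N α = n} := by
  ext α
  constructor
  · rintro ⟨s, ⟨hs, rfl⟩, rfl⟩
    have hlt : ofMultiset s < omega0 ^ γ :=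
      ordOfExponents_lt_omega0_opow fun e he => hs e (by simpa using he)
    refine ⟨hlt, ?_⟩
    rw [ofMultiset, hN.norm_ordOfExponents (Multiset.pairwise_sort s _) (hlt.trans_le hγ),
      ← Multiset.sum_coe, ← Multiset.map_coe, Multiset.sort_eq]
  · rintro ⟨hα, rfl⟩
    obtain ⟨l, hl, rfl⟩ := exists_ordOfExponents_eq α
    refine ⟨l, ⟨fun e he => lt_of_mem_of_ordOfExponents_lt (Multiset.mem_coe.1 he) hα, ?_⟩,
      ofMultiset_coe hl⟩
    rw [hN.norm_ordOfExponents hl (hα.trans_le hγ)]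
    simp

theorem ncard_multisetsOfWeight (hN : IsNorm N) {γ : Ordinal} (hγ : omega0 ^ γ ≤ eps0) (n : ℕ) :
    (multisetsOfWeight (fun e => 1 + N e) (Set.Iio γ) n).ncard =
      {α | α < omega0 ^ γ ∧ N α = n}.ncard := by
  rw [← hN.ofMultiset_image hγ, Set.ncard_image_of_injective _ ofMultiset_injective]

open Finset in
/-- If the counting function of `γ` is negligible compared to its partial sums, then almost every
multiset of ordinals below `γ` contains `0`. -/
theorem eventually_mul_ncard_diff_zero_le (hN : IsNorm N) {γ : Ordinal} (hγ : γ ≤ eps0)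
    (hγ₀ : 0 < γ)
    (h : ∀ K, ∃ n₀, ∀ n ≥ n₀, K * {α | α < γ ∧ N α = n}.ncard ≤
      ∑ k ∈ range (n + 1), {α | α < γ ∧ N α = k}.ncard) (K : ℕ) :
    ∃ n₀, ∀ n ≥ n₀, K * (multisetsOfWeight (fun e => 1 + N e) (Set.Iio γ \ {0}) n).ncard ≤
      (multisetsOfWeight (fun e => 1 + N e) (Set.Iio γ) n).ncard := by
  have h0 : {e ∈ Set.Iio γ | 1 + N e = 0}.ncard = 0 := by
    convert Set.ncard_empty Ordinal
    ext e
    simp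
  have hsucc : ∀ n, {e ∈ Set.Iio γ | 1 + N e = n + 1}.ncard = {α | α < γ ∧ N α = n}.ncard := by
    intro n
    congr 1
    ext e
    simp [add_comm]
  refine eventually_mul_ncard_diff_le (fun _ => Nat.le_add_right _ _)
    (hN.finite_setOf_weight hγ) (Set.mem_Iio.2 hγ₀) (by simp [hN.1]) (fun K => ?_) K
  obtain ⟨n₀, hn₀⟩ := h K
  refine ⟨n₀ + 1, fun n hn => ?_⟩
  obtain ⟨m, rfl⟩ : ∃ m, n = m + 1 := ⟨n - 1, by omega⟩
  rw [sum_range_succ', h0, hsucc]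
  simp only [hsucc]
  exact hn₀ m (by omega)

/-- The counting function of `ω ^ e + b` splits at `ω ^ e`. -/
theorem ncard_setOf_lt_add (hN : IsNorm N) {e b : Ordinal} (hlt : omega0 ^ e + b < eps0)
    (hb : b < omega0 ^ (e + 1)) (n : ℕ) :
    {α | α < omega0 ^ e + b ∧ N α = n}.ncard = {α | α < omega0 ^ e ∧ N α = n}.ncard +
      {x | x < b ∧ 1 + N e + N x = n}.ncard := by
  have hinj : Function.Injective (omega0 ^ e + · : Ordinal → Ordinal) := add_right_injective _
  rw [← Set.ncard_image_of_injective {x | x < b ∧ 1 + N e + N x = n} hinj,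
    ← Set.ncard_union_eq ?_ ?_ ?_]
  · congr 1
    ext α
    constructor
    · rintro ⟨hα, rfl⟩
      rcases lt_or_ge α (omega0 ^ e) with h | h
      · exact Or.inl ⟨h, rfl⟩
      · obtain ⟨x, rfl⟩ := exists_add_of_le h
        have hx := (add_lt_add_iff_left _).1 hα
        exact Or.inr ⟨x, ⟨hx, (hN.2 e x (hα.trans hlt) (hx.trans hb)).symm⟩, rfl⟩
    · rintro (⟨hα, rfl⟩ | ⟨x, ⟨hx, rfl⟩, rfl⟩)
      · exact ⟨hα.trans_le le_self_add, rfl⟩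
      · have h := (add_lt_add_iff_left (omega0 ^ e)).2 hx
        exact ⟨h, hN.2 e x (h.trans hlt) (hx.trans hb)⟩
  · rw [Set.disjoint_left]
    rintro _ ⟨h, _⟩ ⟨x, _, rfl⟩
    exact absurd h (not_lt.2 le_self_add)
  · exact hN.finite_setOf_lt (le_self_add.trans hlt.le) n
  · refine Set.Finite.image _ ((hN.finite_setOf_lt
      (le_add_self.trans hlt.le) (n - (1 + N e))).subset ?_)
    rintro x ⟨hx, rfl⟩
    exact ⟨hx, by omega⟩

open Finset in
/-- The counting function of every `β < ε₀` is negligible compared to its partial sums. -/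
theorem eventually_mul_ncard_le_sum (hN : IsNorm N) (β : Ordinal) (hβ : β < eps0) (K : ℕ) :
    ∃ n₀, ∀ n ≥ n₀, K * {α | α < β ∧ N α = n}.ncard ≤
      ∑ k ∈ range (n + 1), {α | α < β ∧ N α = k}.ncard := by
  induction β using WellFoundedLT.induction generalizing K with
  | ind β ih =>
    rcases eq_or_ne β 0 with rfl | hβ₀
    · exact ⟨0, by simp⟩
    obtain ⟨e, b, rfl, hb, hlt⟩ := exists_eq_omega0_opow_add hβ₀
    have he : omega0 ^ e < eps0 := le_self_add.trans_lt hβ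
    have heps : e < eps0 := (right_le_opow e one_lt_omega0).trans_lt he
    have hopow : ∃ n₀, ∀ n ≥ n₀, K * {α | α < omega0 ^ e ∧ N α = n}.ncard ≤
        ∑ k ∈ range (n + 1), {α | α < omega0 ^ e ∧ N α = k}.ncard := by
      rcases eq_or_ne e 0 with rfl | he₀
      · refine ⟨1, fun n hn => ?_⟩
        have : {α | α < omega0 ^ (0 : Ordinal) ∧ N α = n} = ∅ := by
          ext α
          simp only [opow_zero, Order.lt_one_iff, Set.mem_ofPred_eq, Set.mem_empty_iff_false,
            iff_false]
          rintro ⟨rfl, h⟩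
          rw [hN.1] at h
          omega
        rw [this]
        simp
      · have he₀ := pos_iff_ne_zero.2 he₀
        simp only [← hN.ncard_multisetsOfWeight he.le]
        refine eventually_mul_le_sum _ _ (fun n => ?_) (hN.eventually_mul_ncard_diff_zero_le
          heps.le he₀ fun K => ih e ((lt_omega0_opow_of_lt_eps0 heps).trans_le le_self_add)
            heps K) K
        have := ncard_multisetsOfWeight_eq_add (w := fun e => 1 + N e)
          (fun _ => Nat.le_add_right _ _) (hN.finite_setOf_weight heps.le) (Set.mem_Iio.2 he₀)
          (n := n + 1) (by simp [hN.1])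
        simpa [hN.1] using this
    obtain ⟨n₁, hn₁⟩ := hopow
    obtain ⟨n₂, hn₂⟩ := ih b hlt (hlt.trans hβ) K
    refine ⟨n₁ + n₂ + (1 + N e), fun n hn => ?_⟩
    have hshift : ∀ k, {x | x < b ∧ 1 + N e + N x = k + (1 + N e)}.ncard =
        {x | x < b ∧ N x = k}.ncard := by
      intro k
      congr 1
      ext x
      simp only [Set.mem_ofPred_eq, and_congr_right_iff]
      omega
    obtain ⟨m, rfl⟩ : ∃ m, n = m + (1 + N e) := ⟨n - (1 + N e), by omega⟩
    simp only [hN.ncard_setOf_lt_add hβ hb, sum_add_distrib, mul_add]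
    refine Nat.add_le_add (hn₁ _ (by omega)) ?_
    rw [hshift]
    refine (hn₂ m (by omega)).trans ?_
    rw [show m + (1 + N e) + 1 = (1 + N e) + (m + 1) by omega, sum_range_add _ (1 + N e)]
    refine (sum_le_sum fun k _ => ?_).trans (Nat.le_add_left _ _)
    rw [add_comm (1 + N e) k, hshift]

end IsNorm

/-- The ordinals of the given linear form have Cantor normal forms avoiding the exponents with
zero coefficient. -/
theorem exists_ordOfExponents_eq_of_linear {r : ℕ} {b l : ℕ → ℕ} {i : ℕ} (hi : i ≤ r)
    (hbi : b i = 0) {γ α₀ : Ordinal} (hγ : omega0 ≤ γ) (hα₀ : α₀ < omega0 ^ γ) :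
    ∃ s : List Ordinal, s.Pairwise (· ≥ ·) ∧
      ordOfExponents s = omega0 ^ ((r : Ordinal) + 1) * α₀ + ordOf r (fun i => b i * l i) ∧
      ∀ e ∈ s, e < γ ∧ e ≠ i := by
  obtain ⟨s₁, hs₁, rfl⟩ := exists_ordOfExponents_eq α₀
  obtain ⟨s₂, hs₂, hs₂', hmem⟩ := exists_ordOfExponents_eq_ordOf r (fun i => b i * l i)
  have hcast : (r : Ordinal) + 1 = ((r + 1 : ℕ) : Ordinal) := by simp
  refine ⟨s₁.map ((r : Ordinal) + 1 + ·) ++ s₂, ?_, ?_, ?_⟩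
  · refine List.pairwise_append.2 ⟨?_, hs₂, ?_⟩
    · rw [List.pairwise_map]
      exact hs₁.imp fun h => (add_le_add_iff_left _).2 h
    · intro x hx y hy
      obtain ⟨z, _, rfl⟩ := List.mem_map.1 hx
      obtain ⟨j, hj, rfl, _⟩ := hmem y hy
      refine le_trans ?_ le_self_add
      rw [hcast]
      exact Nat.cast_le.2 (by omega)
  · rw [ordOfExponents_append, ordOfExponents_map_add, hs₂']
  · intro e he
    rcases List.mem_append.1 he with he | he
    · obtain ⟨z, hz, rfl⟩ := List.mem_map.1 he
      rw [hcast]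
      constructor
      · rw [← natCast_add_of_omega0_le hγ (r + 1), add_lt_add_iff_left]
        exact lt_of_mem_of_ordOfExponents_lt hz hα₀
      · refine ((?_ : (i : Ordinal) < _).trans_le le_self_add).ne'
        exact Nat.cast_lt.2 (by omega)
    · obtain ⟨j, hj, rfl, h⟩ := hmem e he
      refine ⟨(natCast_lt_omega0 j).trans_le hγ, fun hji => h ?_⟩
      rw [Nat.cast_inj.1 hji, hbi, zero_mul]

open Filter in
/-- For `ω^ω ≤ β = ω^γ < ε₀`, if some `b_i = 0` (`i ≤ r`) then the density of
`L = {ω^{r+1}·α₀ + ω^r·(b_r l_r) + ⋯ + ω^0·(b_0 l_0) : α₀ < β, l_i ∈ ℕ}` tends to `0`. -/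
theorem linear_set_density_zero_above_omega_omega (N : Ordinal → ℕ) (hN : IsNorm N)
    (β γ : Ordinal) (hβγ : β = omega0 ^ γ)
    (hβ₁ : omega0 ^ omega0 ≤ β) (hβ₂ : β < eps0)
    (r : ℕ) (b : ℕ → ℕ) (hb : ∃ i ≤ r, b i = 0)
    (L : Set Ordinal)
    (hL : L = {α | ∃ α₀ < β, ∃ l : ℕ → ℕ,
        α = omega0 ^ ((r : Ordinal) + 1) * α₀ + ordOf r fun i => b i * l i})
    (D : ℕ → ℝ)
    (hD : ∀ m, D m = ({α ∈ L | N α = m}.ncard : ℝ) /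
      ({α : Ordinal | α < β ∧ N α = m}.ncard : ℝ)) :
    Tendsto D atTop (nhds 0) := by
  obtain ⟨i, hi, hbi⟩ := hb
  subst hβγ
  have hγ : omega0 ≤ γ := (opow_le_opow_iff_right one_lt_omega0).1 hβ₁
  have hγ₀ : 0 < γ := omega0_pos.trans_le hγ
  have hγeps : γ < eps0 := (right_le_opow γ one_lt_omega0).trans_lt hβ₂
  have hfin : ∀ n, {e ∈ Set.Iio γ | 1 + N e = n}.Finite := hN.finite_setOf_weight hγeps.le
  have hfin_diff : ∀ n, {e ∈ Set.Iio γ \ {(i : Ordinal)} | 1 + N e = n}.Finite := fun n =>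
    (hfin n).subset fun e he => ⟨he.1.1, he.2⟩
  have hL_card : ∀ m, {α ∈ L | N α = m}.ncard ≤
      (multisetsOfWeight (fun e => 1 + N e) (Set.Iio γ \ {(i : Ordinal)}) m).ncard := by
    intro m
    have hM := finite_multisetsOfWeight (w := fun e => 1 + N e)
      (fun _ => Nat.le_add_right _ _) hfin_diff m
    refine (Set.ncard_le_ncard (t := IsNorm.ofMultiset '' _) ?_ (hM.image _)).trans
      (Set.ncard_image_le hM)
    rintro α ⟨hα, rfl⟩
    rw [hL] at hα
    obtain ⟨α₀, hα₀, l, rfl⟩ := hα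
    obtain ⟨s, hs, hs', hmem⟩ := exists_ordOfExponents_eq_of_linear (l := l) hi hbi hγ hα₀
    rw [← hs']
    have hlt : ordOfExponents s < eps0 :=
      (ordOfExponents_lt_omega0_opow fun e he => (hmem e he).1).trans hβ₂
    refine ⟨s, ⟨hmem, ?_⟩, IsNorm.ofMultiset_coe hs⟩
    rw [hN.norm_ordOfExponents hs hlt]
    simp
  rw [Metric.tendsto_atTop]
  intro ε hε
  obtain ⟨K, hK⟩ := exists_nat_gt ε⁻¹
  obtain ⟨n₀, hn₀⟩ := eventually_mul_ncard_diff_le_of_weight_one (w := fun e => 1 + N e)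
    (fun _ => Nat.le_add_right _ _) hfin (Set.mem_Iio.2 hγ₀) (by simp [hN.1])
    (hN.eventually_mul_ncard_diff_zero_le hγeps.le hγ₀
      (hN.eventually_mul_ncard_le_sum γ hγeps))
    (Set.mem_Iio.2 ((natCast_lt_omega0 i).trans_le hγ)) K
  refine ⟨n₀, fun n hn => ?_⟩
  have h := (Nat.mul_le_mul_left K (hL_card n)).trans (hn₀ n hn)
  rw [hN.ncard_multisetsOfWeight hβ₂.le] at h
  rw [Real.dist_eq, _root_.sub_zero, hD, abs_of_nonneg (by positivity)]
  have hK₀ : (0 : ℝ) < K := (inv_pos.2 hε).trans hK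
  refine lt_of_le_of_lt ?_ (inv_lt_of_inv_lt₀ hε hK)
  rw [inv_eq_one_div, le_div_iff₀ hK₀, div_mul_eq_mul_div]
  refine div_le_one_of_le₀ ?_ (by positivity)
  rw [mul_comm]
  exact_mod_cast h
end

section
/- For every ordinal β with ω^ω ≤ β < ε₀ and every semilinear subset L of β, the limit density lim_{n→∞} D_L(n) exists and is a rational number. -/
open Ordinal

/-- The linear subset of `β` with parameters `r, a_i, b_i`:
`{ω^{r+1}·α₀ + ω^r·(a_r + b_r l_r) + ⋯ + ω^0·(a_0 + b_0 l_0) : α₀ < β, l_i ∈ ℕ} ∩ β`. -/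
noncomputable def linSetAbove (β : Ordinal) (r : ℕ) (a b : ℕ → ℕ) : Set Ordinal :=
  {α | α < β ∧ ∃ α₀ < β, ∃ l : ℕ → ℕ,
      α = omega0 ^ ((r : Ordinal) + 1) * α₀ + ordOf r fun i => a i + b i * l i}

/-- A semilinear subset of `β` is a finite union of linear subsets. -/
def IsSemilinearAbove (β : Ordinal) (L : Set Ordinal) : Prop :=
  ∃ (n : ℕ) (r : Fin n → ℕ) (a b : Fin n → ℕ → ℕ),
    L = ⋃ j : Fin n, linSetAbove β (r j) (a j) (b j)

section

open Filter Asymptotics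

variable {ι : Type*}

/-- A nonnegative sequence has slow growth if its upper growth ratio is at most `1`. -/
def SlowGrowth (f : ℕ → ℝ) : Prop :=
  ∀ ρ > 1, ∀ᶠ d in atTop, f (d + 1) ≤ ρ * f d

theorem SlowGrowth.congr {f g : ℕ → ℝ} (hf : SlowGrowth f) (h : ∀ᶠ d in atTop, f d = g d) :
    SlowGrowth g := by
  intro ρ hρ
  filter_upwards [hf ρ hρ, h, (tendsto_add_atTop_nat 1).eventually h] with d h₁ h₂ h₃
  rwa [← h₂, ← h₃]

theorem SlowGrowth.add {f g : ℕ → ℝ} (hf : SlowGrowth f) (hg : SlowGrowth g) :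
    SlowGrowth fun d => f d + g d := by
  intro ρ hρ
  filter_upwards [hf ρ hρ, hg ρ hρ] with d h₁ h₂
  linarith

theorem SlowGrowth.comp_sub {f : ℕ → ℝ} (hf : SlowGrowth f) (s : ℕ) :
    SlowGrowth fun d => f (d - s) := by
  intro ρ hρ
  filter_upwards [(tendsto_sub_atTop_nat s).eventually (hf ρ hρ), eventually_ge_atTop s]
    with d h hd
  rwa [Nat.sub_add_comm hd]

theorem SlowGrowth.natCast_mul {f : ℕ → ℝ} (hf : SlowGrowth f) (h₀ : ∀ d, 0 ≤ f d) :
    SlowGrowth fun d => d * f d := by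
  intro ρ hρ
  have hσ : 1 < (1 + ρ) / 2 := by linarith
  filter_upwards [hf _ hσ, tendsto_natCast_atTop_atTop.eventually_ge_atTop
    ((1 + ρ) / 2 / ((ρ - 1) / 2))] with d h hd
  rw [div_le_iff₀ (by linarith)] at hd
  push_cast
  calc ((d : ℝ) + 1) * f (d + 1) ≤ (d + 1) * ((1 + ρ) / 2 * f d) := by gcongr
    _ = ((d + 1) * ((1 + ρ) / 2)) * f d := by ring
    _ ≤ (ρ * d) * f d := mul_le_mul_of_nonneg_right (by linarith) (h₀ d)
    _ = _ := by ring

/-- A single term of a slowly growing sequence is negligible against the partial sums. -/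
theorem SlowGrowth.le_sum {q : ℕ → ℝ} (hq : SlowGrowth q) (h₀ : ∀ d, 0 ≤ q d) {ε : ℝ}
    (hε : 0 < ε) : ∃ C, 0 ≤ C ∧ ∀ m, q m ≤ ε * ∑ i ∈ Finset.range (m + 1), q i + C := by
  obtain ⟨J, hJ⟩ := exists_nat_gt (2 / ε)
  have hlim : Tendsto (fun ρ : ℝ => ρ ^ J) (nhdsWithin 1 (Set.Ioi 1)) (nhds 1) := by
    have : ContinuousAt (fun ρ : ℝ => ρ ^ J) 1 := by fun_prop
    simpa using this.tendsto.mono_left nhdsWithin_le_nhds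
  obtain ⟨ρ, hρ2, hρ1⟩ :=
    ((hlim.eventually_lt_const (by norm_num : (1 : ℝ) < 2)).and self_mem_nhdsWithin).exists
  have hρ1 : 1 < ρ := hρ1
  obtain ⟨d₀, hd₀⟩ := eventually_atTop.1 (hq ρ hρ1)
  have key : ∀ j d, d₀ ≤ d → q (d + j) ≤ ρ ^ j * q d := by
    intro j
    induction j with
    | zero => intro d _; simp
    | succ j ih =>
      intro d hd
      calc q (d + (j + 1)) ≤ ρ * q (d + j) := hd₀ (d + j) (by omega)
        _ ≤ ρ * (ρ ^ j * q d) := by gcongr; exact ih d hd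
        _ = _ := by ring
  refine ⟨∑ i ∈ Finset.range (d₀ + J), q i, Finset.sum_nonneg fun i _ => h₀ i, fun m => ?_⟩
  have hS : 0 ≤ ∑ i ∈ Finset.range (m + 1), q i := Finset.sum_nonneg fun i _ => h₀ i
  have hS' : 0 ≤ ∑ i ∈ Finset.range (d₀ + J), q i := Finset.sum_nonneg fun i _ => h₀ i
  rcases lt_or_ge m (d₀ + J) with hm | hm
  · have := Finset.single_le_sum (f := q) (fun i _ => h₀ i) (Finset.mem_range.2 hm)
    nlinarith
  · have h1 : ∑ j ∈ Finset.range J, q m ≤ ∑ j ∈ Finset.range J, 2 * q (m - j) := by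
      refine Finset.sum_le_sum fun j hj => ?_
      have hj := Finset.mem_range.1 hj
      have := key j (m - j) (by omega)
      rw [Nat.sub_add_cancel (by omega)] at this
      refine this.trans ?_
      have : ρ ^ j ≤ ρ ^ J := pow_le_pow_right₀ hρ1.le hj.le
      have := h₀ (m - j)
      gcongr
      linarith
    have h2 : ∑ j ∈ Finset.range J, q (m - j) ≤ ∑ i ∈ Finset.range (m + 1), q i := by
      rw [← Finset.sum_range_reflect q (m + 1)]
      simp only [Nat.add_sub_cancel]
      refine (Finset.sum_le_sum_of_subset_of_nonneg
        (Finset.range_subset_range.2 (by omega : J ≤ m + 1)) fun i _ _ => h₀ _).trans_eq ?_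
      exact Finset.sum_congr rfl fun j _ => rfl
    rw [← Finset.mul_sum] at h1
    simp only [Finset.sum_const, Finset.card_range, _root_.nsmul_eq_mul] at h1
    rw [div_lt_iff₀ hε] at hJ
    have h3 : 2 * q m ≤ (J * ε) * q m := by
      gcongr
      exact h₀ m
    nlinarith

/-- The divisor sums of a slowly growing sequence are negligible against their partial sums. -/
theorem SlowGrowth.divisorSum_le {q : ℕ → ℝ} (hq : SlowGrowth q) (h₀ : ∀ d, 0 ≤ q d)
    (hq₀ : q 0 = 0) {ε : ℝ} (hε : 0 < ε) : ∃ C, ∀ k : ℕ, ∑ d ∈ k.divisors, q d ≤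
      ε * ∑ i ∈ Finset.range (k + 1), ∑ d ∈ Nat.divisors i, q d + C := by
  obtain ⟨c₀, hc₀⟩ := exists_nat_gt (2 / ε)
  have hc₀' : 0 < (c₀ : ℝ) := lt_trans (by positivity) hc₀
  obtain ⟨C, hC, h⟩ := hq.le_sum h₀ (ε := ε / (2 * c₀)) (by positivity)
  refine ⟨c₀ * C, fun k => ?_⟩
  set H := ∑ i ∈ Finset.range (k + 1), ∑ d ∈ Nat.divisors i, q d with hH
  have hlarge : ∀ m ≤ k, q m ≤ ε / (2 * c₀) * H + C := by
    intro m hm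
    refine (h m).trans ?_
    gcongr
    refine (Finset.sum_le_sum_of_subset_of_nonneg
      (Finset.range_subset_range.2 (Nat.succ_le_succ hm)) fun i _ _ => h₀ _).trans ?_
    refine Finset.sum_le_sum fun i _ => ?_
    rcases Nat.eq_zero_or_pos i with rfl | hi
    · simp [hq₀]
    · exact Finset.single_le_sum (f := q) (fun d _ => h₀ d) (by simp [hi.ne'])
  have hsmall : ∑ d ∈ k.divisors, q d * (k / d : ℕ) ≤ H := by
    have h1 : ∑ i ∈ Finset.Ioc 0 k, ∑ d ∈ Nat.divisors i, q d =
        ∑ d ∈ Finset.Ioc 0 k, q d * (k / d : ℕ) := by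
      convert ArithmeticFunction.sum_Ioc_mul_zeta_eq_sum (R := ℝ) ⟨q, hq₀⟩ k using 2
      · exact (ArithmeticFunction.coe_mul_zeta_apply (R := ℝ) (f := ⟨q, hq₀⟩)).symm
      · rfl
    have h2 : H = ∑ i ∈ Finset.Ioc 0 k, ∑ d ∈ Nat.divisors i, q d := by
      refine (Finset.sum_subset (fun i hi => ?_) fun i hi hi' => ?_).symm
      · simp only [Finset.mem_Ioc, Finset.mem_range] at *
        omega
      · obtain rfl : i = 0 := by
          simp only [Finset.mem_Ioc, Finset.mem_range] at *
          omega
        simp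
    rw [h2, h1]
    refine Finset.sum_le_sum_of_subset_of_nonneg (fun d hd => ?_)
      fun i _ _ => mul_nonneg (h₀ i) (Nat.cast_nonneg _)
    exact Finset.mem_Ioc.2 ⟨Nat.pos_of_mem_divisors hd, Nat.divisor_le hd⟩
  have hH₀ : 0 ≤ H := Finset.sum_nonneg fun i _ => Finset.sum_nonneg fun d _ => h₀ d
  rw [← Finset.sum_filter_add_sum_filter_not _ fun d => c₀ ≤ k / d]
  have h1 : c₀ * ∑ d ∈ k.divisors with c₀ ≤ k / d, q d ≤ H := by
    refine le_trans ?_ hsmall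
    rw [Finset.mul_sum]
    refine le_trans (Finset.sum_le_sum fun d hd => ?_)
      (Finset.sum_le_sum_of_subset_of_nonneg (Finset.filter_subset _ _)
        fun i _ _ => mul_nonneg (h₀ i) (Nat.cast_nonneg _))
    rw [mul_comm]
    exact mul_le_mul_of_nonneg_left (by exact_mod_cast (Finset.mem_filter.1 hd).2) (h₀ d)
  have h2 : ∑ d ∈ k.divisors with ¬ c₀ ≤ k / d, q d ≤ c₀ * (ε / (2 * c₀) * H + C) := by
    have hcard : ({d ∈ k.divisors | ¬ c₀ ≤ k / d}).card ≤ c₀ := by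
      conv_rhs => rw [← Finset.card_range c₀]
      refine Finset.card_le_card_of_injOn (fun d => k / d) (fun d hd => ?_)
        fun d hd e he hde => ?_
      · simpa using (Finset.mem_filter.1 hd).2
      · have hd := Nat.mem_divisors.1 (Finset.mem_filter.1 hd).1
        have he := Nat.mem_divisors.1 (Finset.mem_filter.1 he).1
        rw [← Nat.div_div_self hd.1 hd.2, ← Nat.div_div_self he.1 he.2]
        exact congrArg (k / ·) hde
    refine (Finset.sum_le_card_nsmul _ _ _ fun d hd =>
      hlarge d (Nat.divisor_le (Finset.mem_filter.1 hd).1)).trans ?_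
    rw [_root_.nsmul_eq_mul]
    gcongr
  have h3 : ∑ d ∈ k.divisors with c₀ ≤ k / d, q d ≤ ε / 2 * H := by
    rw [div_lt_iff₀ hε] at hc₀
    have : c₀ * ∑ d ∈ k.divisors with c₀ ≤ k / d, q d ≤ c₀ * (ε / 2 * H) := by
      nlinarith
    exact le_of_mul_le_mul_left this hc₀'
  have h4 : c₀ * (ε / (2 * c₀) * H + C) = ε / 2 * H + c₀ * C := by
    field_simp
  linarith

/-- If `n * a' n` is the convolution of `a'` with the divisor sums of a slowly growing sequence,
then `a'` is negligible against its partial sums. -/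
theorem isLittleO_sum_of_divisorSum {q a' a : ℕ → ℝ} (hq : SlowGrowth q) (h₀ : ∀ d, 0 ≤ q d)
    (hq₀ : q 0 = 0) (ha' : ∀ n, 0 ≤ a' n) (ha : ∀ n, a n = ∑ i ∈ Finset.range (n + 1), a' i)
    (hconv : ∀ n : ℕ, n * a' n =
      ∑ k ∈ Finset.range (n + 1), (∑ d ∈ k.divisors, q d) * a' (n - k)) :
    a' =o[atTop] a := by
  set h : ℕ → ℝ := fun k => ∑ d ∈ k.divisors, q d with hh
  have hsum : ∀ n, ∑ k ∈ Finset.range (n + 1), (∑ i ∈ Finset.range (k + 1), h i) * a' (n - k) =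
      ∑ m ∈ Finset.range (n + 1), m * a' m := by
    intro n
    have := congrArg (PowerSeries.coeff n) (mul_right_comm (PowerSeries.mk h)
      (PowerSeries.mk fun _ => 1) (PowerSeries.mk a'))
    simp only [PowerSeries.coeff_mul, PowerSeries.coeff_mk,
      Finset.Nat.sum_antidiagonal_eq_sum_range_succ_mk, mul_one] at this
    rw [this]
    exact Finset.sum_congr rfl fun m _ => (hconv m).symm
  refine isLittleO_iff.2 fun ε hε => ?_
  obtain ⟨C, hC⟩ := hq.divisorSum_le h₀ hq₀ (ε := ε / 2) (by positivity)
  filter_upwards [tendsto_natCast_atTop_atTop.eventually_ge_atTop (C / (ε / 2)),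
    eventually_gt_atTop 0] with n hn hn₀
  have hn₀ : (0 : ℝ) < n := by exact_mod_cast hn₀
  have han : 0 ≤ a n := by rw [ha]; exact Finset.sum_nonneg fun i _ => ha' i
  rw [Real.norm_of_nonneg (ha' n), Real.norm_of_nonneg han]
  have h1 : n * a' n ≤ ε / 2 * (n * a n) + C * a n := by
    have hCa : ∑ k ∈ Finset.range (n + 1), C * a' (n - k) = C * a n := by
      rw [← Finset.mul_sum, ha, ← Finset.sum_range_reflect a' (n + 1)]
      rfl
    have hna : ∑ m ∈ Finset.range (n + 1), m * a' m ≤ n * a n := by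
      rw [ha, Finset.mul_sum]
      refine Finset.sum_le_sum fun m hm => ?_
      have := ha' m
      have : m ≤ n := Nat.lt_succ_iff.1 (Finset.mem_range.1 hm)
      gcongr
    calc n * a' n = ∑ k ∈ Finset.range (n + 1), h k * a' (n - k) := hconv n
      _ ≤ ∑ k ∈ Finset.range (n + 1),
          (ε / 2 * ∑ i ∈ Finset.range (k + 1), h i + C) * a' (n - k) := by
        refine Finset.sum_le_sum fun k _ => ?_
        exact mul_le_mul_of_nonneg_right (hC k) (ha' _)
      _ = ε / 2 * ∑ m ∈ Finset.range (n + 1), m * a' m + C * a n := by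
        rw [← hsum, ← hCa, Finset.mul_sum, ← Finset.sum_add_distrib]
        exact Finset.sum_congr rfl fun k _ => by ring
      _ ≤ _ := by gcongr
  rw [div_le_iff₀ (by positivity)] at hn
  have h2 : C * a n ≤ n * (ε / 2) * a n := mul_le_mul_of_nonneg_right hn han
  refine le_of_mul_le_mul_left (a := (n : ℝ)) ?_ hn₀
  linarith

/-- The finitely supported multiplicity functions on `E` of total weight `n`. -/
def conf (E : Set ι) (w : ι → ℕ) (n : ℕ) : Set (ι →₀ ℕ) :=
  {f | ↑f.support ⊆ E ∧ Finsupp.weight w f = n}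

/-- The number of multisets on `E` of total weight `n`. -/
noncomputable def cnt (E : Set ι) (w : ι → ℕ) (n : ℕ) : ℕ := (conf E w n).ncard

/-- The number of elements of `E` of weight `d`. -/
noncomputable def parts (E : Set ι) (w : ι → ℕ) (d : ℕ) : ℕ := {e ∈ E | w e = d}.ncard

/-- A weight on `E` is positive with finitely many elements of bounded weight. -/
structure IsWeight (E : Set ι) (w : ι → ℕ) : Prop where
  pos : ∀ e ∈ E, 0 < w e
  finite : ∀ d, {e ∈ E | w e ≤ d}.Finite

theorem IsWeight.mono {E F : Set ι} {w : ι → ℕ} (h : IsWeight E w) (hF : F ⊆ E) :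
    IsWeight F w :=
  ⟨fun e he => h.pos e (hF he), fun d => (h.finite d).subset fun _ he => ⟨hF he.1, he.2⟩⟩

theorem IsWeight.of_eq_off {E : Set ι} {w w' : ι → ℕ} (h : IsWeight E w) (hpos : ∀ e ∈ E, 0 < w' e)
    (I : Finset ι) (hI : ∀ e ∉ I, w e = w' e) : IsWeight E w' := by
  refine ⟨hpos, fun d => ((h.finite d).union I.finite_toSet).subset fun e he => ?_⟩
  by_cases heI : e ∈ I
  · exact Or.inr heI
  · exact Or.inl ⟨he.1, (hI e heI).trans_le he.2⟩

theorem conf_subset {E : Set ι} {w : ι → ℕ} (h : IsWeight E w) (n : ℕ) :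
    conf E w n ⊆ (h.finite n).toFinset.finsupp fun _ => Finset.range (n + 1) := by
  intro f hf
  have hmem : ∀ e, f e ≠ 0 → e ∈ E := fun e he => hf.1 (by simpa using he)
  rw [Finset.mem_coe, Finset.mem_finsupp_iff]
  refine ⟨fun e he => ?_, fun e he => ?_⟩
  · have he : f e ≠ 0 := by simpa using he
    simp only [Set.Finite.mem_toFinset, Set.mem_ofPred_eq]
    exact ⟨hmem e he, hf.2 ▸ Finsupp.le_weight_of_ne_zero' w he⟩
  · simp only [Set.Finite.mem_toFinset, Set.mem_ofPred_eq] at he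
    rw [Finset.mem_range, Nat.lt_succ_iff, ← hf.2]
    exact Finsupp.le_weight w (h.pos e he.1).ne' f

theorem finite_conf {E : Set ι} {w : ι → ℕ} (h : IsWeight E w) (n : ℕ) : (conf E w n).Finite :=
  (Finset.finite_toSet _).subset (conf_subset h n)

theorem weight_pointwise_smul (w P : ι → ℕ) (g : ι →₀ ℕ) :
    Finsupp.weight w (P • g) = Finsupp.weight (P * w) g := by
  rw [Finsupp.weight_apply, Finsupp.weight_apply, Finsupp.sum_of_support_subset (s := g.support)]
  · exact Finset.sum_congr rfl fun e _ => by simp; ring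
  · intro e he
    simp_all
  · simp

/-- Members of `conf E w n` that dominate `c` and agree with it modulo `P`. -/
def resid (E : Set ι) (w P : ι → ℕ) (c : ι →₀ ℕ) (n : ℕ) : Set (ι →₀ ℕ) :=
  {f ∈ conf E w n | ∃ g, f = c + P • g}

theorem ncard_resid {E : Set ι} {w P : ι → ℕ} (hP : ∀ e, 0 < P e) {c : ι →₀ ℕ}
    (hc : ↑c.support ⊆ E) (n : ℕ) : (resid E w P c n).ncard =
      if Finsupp.weight w c ≤ n then cnt E (P * w) (n - Finsupp.weight w c) else 0 := by
  split_ifs with h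
  · have : resid E w P c n = (fun g => c + P • g) '' conf E (P * w) (n - Finsupp.weight w c) := by
      ext f
      constructor
      · rintro ⟨⟨h1, h2⟩, g, rfl⟩
        refine ⟨g, ⟨fun e he => h1 ?_, ?_⟩, rfl⟩
        · have hg : g e ≠ 0 := by simpa using he
          have : c e + P e * g e ≠ 0 :=
            (Nat.add_pos_right _ (Nat.mul_pos (hP e) (Nat.pos_of_ne_zero hg))).ne'
          simpa using this
        · rw [map_add, weight_pointwise_smul] at h2
          omega
      · rintro ⟨g, ⟨h1, h2⟩, rfl⟩
        refine ⟨⟨fun e he => ?_, ?_⟩, g, rfl⟩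
        · by_cases hce : c e = 0
          · refine h1 ?_
            simp_all
          · exact hc (by simpa using hce)
        · rw [map_add, weight_pointwise_smul, h2]
          omega
    rw [this, cnt, Set.ncard_image_of_injective]
    intro g g' hg
    ext e
    have := DFunLike.congr_fun hg e
    simpa [(hP e).ne'] using this
  · convert Set.ncard_empty (ι →₀ ℕ)
    refine Set.eq_empty_of_forall_notMem ?_
    rintro f ⟨⟨h1, h2⟩, g, rfl⟩
    rw [map_add] at h2
    omega

theorem ncard_conf_le {E : Set ι} {w : ι → ℕ} {e : ι} (he : e ∈ E) (i n : ℕ) :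
    {f ∈ conf E w n | i ≤ f e}.ncard = if i * w e ≤ n then cnt E w (n - i * w e) else 0 := by
  have h := ncard_resid (E := E) (w := w) (P := 1) (c := Finsupp.single e i) (fun _ => Nat.one_pos)
    (fun x hx => by
      obtain rfl : x = e := by
        by_contra hne
        simp [Ne.symm hne] at hx
      exact he) n
  rw [one_mul, Finsupp.weight_single, _root_.smul_eq_mul] at h
  rw [← h]
  congr 1
  ext f
  refine and_congr_right fun _ => ⟨fun hf => ⟨f - Finsupp.single e i, ?_⟩, ?_⟩
  · ext x
    by_cases hx : x = e
    · subst hx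
      simp [hf]
    · simp [Ne.symm hx]
  · rintro ⟨g, rfl⟩
    simp

theorem cnt_eq_add_cnt_diff {E : Set ι} {w : ι → ℕ} (h : IsWeight E w) {x : ι} (hx : x ∈ E)
    (n : ℕ) : cnt E w n =
      (if w x ≤ n then cnt E w (n - w x) else 0) + cnt (E \ {x}) w n := by
  have h1 := ncard_conf_le (w := w) hx 1 n
  rw [one_mul] at h1
  rw [← h1, cnt, cnt, ← Set.ncard_union_eq ?_ ((finite_conf h n).subset (Set.sep_subset _ _))
    (finite_conf (h.mono Set.sdiff_subset) n)]
  · congr 1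
    ext f
    simp only [conf, Set.mem_ofPred_eq, Set.mem_union]
    constructor
    · rintro ⟨h1, h2⟩
      rcases Nat.eq_zero_or_pos (f x) with h0 | h0
      · refine Or.inr ⟨fun e he => ⟨h1 he, ?_⟩, h2⟩
        rintro rfl
        simp_all
      · exact Or.inl ⟨⟨h1, h2⟩, h0⟩
    · rintro (h | h)
      · exact h.1
      · exact ⟨h.1.trans Set.sdiff_subset, h.2⟩
  · rw [Set.disjoint_left]
    rintro f ⟨_, h1⟩ ⟨h2, _⟩
    have : x ∈ E \ {x} := h2 (by simp; omega)
    exact this.2 rfl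

theorem cnt_eq_sum_diff {E : Set ι} {w : ι → ℕ} (h : IsWeight E w) {x : ι} (hx : x ∈ E)
    (hwx : w x = 1) (n : ℕ) :
    cnt E w n = ∑ i ∈ Finset.range (n + 1), cnt (E \ {x}) w i := by
  induction n with
  | zero => rw [cnt_eq_add_cnt_diff h hx]; simp [hwx]
  | succ n ih => rw [cnt_eq_add_cnt_diff h hx, Finset.sum_range_succ, ← ih]; simp [hwx]

theorem mul_cnt_eq_sum {E : Set ι} {w : ι → ℕ} (h : IsWeight E w) (n : ℕ) :
    n * cnt E w n = ∑ k ∈ Finset.range (n + 1),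
      (∑ d ∈ k.divisors, d * parts E w d) * cnt E w (n - k) := by
  classical
  set F := (h.finite n).toFinset with hF
  have hFmem : ∀ e, e ∈ F ↔ e ∈ E ∧ w e ≤ n := by simp [hF]
  set A := (finite_conf h n).toFinset with hA
  have hAmem : ∀ f, f ∈ A ↔ f ∈ conf E w n := by simp [hA]
  have hcol : ∀ e ∈ F, ∑ f ∈ A, f e =
      ∑ k ∈ Finset.range (n + 1) with k ≠ 0 ∧ w e ∣ k, cnt E w (n - k) := by
    intro e he
    have hE := ((hFmem e).1 he).1
    have hpos := h.pos e hE
    have h1 : ∀ f ∈ A, f e = ∑ i ∈ Finset.Icc 1 n, if i ≤ f e then 1 else 0 := by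
      intro f hf
      have hle : f e ≤ n := ((hAmem f).1 hf).2 ▸ Finsupp.le_weight w hpos.ne' f
      rw [← Finset.sum_filter, Finset.sum_const, _root_.smul_eq_mul, mul_one]
      have : {i ∈ Finset.Icc 1 n | i ≤ f e} = Finset.Icc 1 (f e) := by
        ext i; simp; omega
      rw [this]; simp
    rw [Finset.sum_congr rfl h1, Finset.sum_comm]
    have h2 : ∀ i, (∑ f ∈ A, if i ≤ f e then 1 else 0) =
        if i * w e ≤ n then cnt E w (n - i * w e) else 0 := by
      intro i
      rw [← ncard_conf_le hE, ← Finset.sum_filter, Finset.sum_const, _root_.smul_eq_mul, mul_one,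
        ← Set.ncard_coe_finset]
      congr 1
      ext f
      simp [hAmem]
    simp only [h2]
    rw [← Finset.sum_filter]
    refine Finset.sum_nbij (fun i => i * w e) ?_ ?_ ?_ fun _ _ => rfl
    · intro i hi
      simp only [Finset.mem_filter, Finset.mem_Icc, Finset.mem_range] at hi ⊢
      exact ⟨by omega, (Nat.mul_pos (by omega) hpos).ne', Dvd.intro_left _ rfl⟩
    · intro i _ j _ hij
      exact Nat.eq_of_mul_eq_mul_right hpos hij
    · rintro k hk
      simp only [Finset.coe_filter, Finset.mem_range, Set.mem_ofPred_eq] at hk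
      obtain ⟨hk, hk0, j, rfl⟩ := hk
      refine ⟨j, ?_, Nat.mul_comm _ _⟩
      simp only [Finset.coe_filter, Finset.mem_Icc, Set.mem_ofPred_eq]
      have : j ≠ 0 := by rintro rfl; simp at hk0
      refine ⟨⟨by omega, ?_⟩, by rw [Nat.mul_comm]; omega⟩
      nlinarith
  have hLHS : n * cnt E w n = ∑ e ∈ F, w e * ∑ f ∈ A, f e := by
    have h1 : ∀ f ∈ A, n = ∑ e ∈ F, w e * f e := by
      intro f hf
      have hf' := (hAmem f).1 hf
      have hsub := (Finset.mem_finsupp_iff.1 (conf_subset h n hf')).1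
      rw [← hf'.2, Finsupp.weight_apply, Finsupp.sum_of_support_subset _ hsub _ (by simp)]
      exact Finset.sum_congr rfl fun e _ => by rw [_root_.smul_eq_mul, mul_comm]
    simp only [Finset.mul_sum]
    rw [Finset.sum_comm, ← Finset.sum_congr rfl h1, Finset.sum_const, _root_.smul_eq_mul, mul_comm, cnt,
      Set.ncard_eq_toFinset_card _ (finite_conf h n)]
  have hparts : ∀ d ≤ n, parts E w d = ∑ e ∈ F, if w e = d then 1 else 0 := by
    intro d hd
    rw [← Finset.sum_filter, Finset.sum_const, _root_.smul_eq_mul, mul_one, parts,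
      ← Set.ncard_coe_finset]
    congr 1
    ext e
    simp only [Set.mem_ofPred_eq, Finset.coe_filter, hFmem]
    exact ⟨fun he => ⟨⟨he.1, he.2.trans_le hd⟩, he.2⟩, fun he => ⟨he.1.1, he.2⟩⟩
  have hh : ∀ k ∈ Finset.range (n + 1), (∑ d ∈ k.divisors, d * parts E w d) * cnt E w (n - k) =
      ∑ e ∈ F, if k ≠ 0 ∧ w e ∣ k then w e * cnt E w (n - k) else 0 := by
    intro k hk
    have hk := Finset.mem_range.1 hk
    have h1 : ∑ d ∈ k.divisors, d * parts E w d =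
        ∑ e ∈ F, if k ≠ 0 ∧ w e ∣ k then w e else 0 := by
      have : ∀ d ∈ k.divisors, d * parts E w d = ∑ e ∈ F, if w e = d then d else 0 := by
        intro d hd
        rw [hparts d ((Nat.divisor_le hd).trans (by omega)), Finset.mul_sum]
        simp
      rw [Finset.sum_congr rfl this, Finset.sum_comm]
      refine Finset.sum_congr rfl fun e _ => ?_
      rw [Finset.sum_ite_eq]
      simp [and_comm]
    rw [h1, Finset.sum_mul]
    exact Finset.sum_congr rfl fun e _ => by split_ifs <;> simp
  rw [Finset.sum_congr rfl hh, Finset.sum_comm, hLHS]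
  refine Finset.sum_congr rfl fun e he => ?_
  rw [hcol e he, Finset.mul_sum, Finset.sum_filter]

theorem parts_eventuallyEq {E E' : Set ι} {w w' : ι → ℕ} (I : Finset ι)
    (hw : ∀ e ∉ I, w e = w' e) (hE : ∀ e ∉ I, e ∈ E ↔ e ∈ E') :
    ∀ᶠ d in atTop, (parts E w d : ℝ) = parts E' w' d := by
  filter_upwards [eventually_gt_atTop (∑ e ∈ I, (w e + w' e))] with d hd
  rw [parts, parts]
  congr 2
  ext e
  by_cases he : e ∈ I
  · have := Finset.single_le_sum (f := fun e => w e + w' e) (fun _ _ => Nat.zero_le _) he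
    simp only [Set.mem_ofPred_eq]
    constructor <;> intro h <;> omega
  · simp only [Set.mem_ofPred_eq]
    rw [hw e he, hE e he]

theorem isLittleO_cnt_diff {E : Set ι} {w : ι → ℕ} (h : IsWeight E w)
    (hs : SlowGrowth fun d => (parts E w d : ℝ)) {x : ι} (hx : x ∈ E) (hwx : w x = 1) :
    (fun n => (cnt (E \ {x}) w n : ℝ)) =o[atTop] fun n => (cnt E w n : ℝ) := by
  have hs' : SlowGrowth fun d => (parts (E \ {x}) w d : ℝ) :=
    hs.congr (parts_eventuallyEq {x} (fun _ _ => rfl) fun e he => by simp_all)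
  refine isLittleO_sum_of_divisorSum (hs'.natCast_mul fun d => Nat.cast_nonneg _)
    (fun d => by positivity) (by simp) (fun n => Nat.cast_nonneg _)
    (fun n => by rw [cnt_eq_sum_diff h hx hwx]; push_cast; rfl) fun n => ?_
  exact_mod_cast mul_cnt_eq_sum (h.mono (Set.sdiff_subset (t := {x}))) n

theorem slowGrowth_cnt {E : Set ι} {w : ι → ℕ} (h : IsWeight E w)
    (hs : SlowGrowth fun d => (parts E w d : ℝ)) {x : ι} (hx : x ∈ E) (hwx : w x = 1) :
    SlowGrowth fun n => (cnt E w n : ℝ) := by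
  intro ρ hρ
  have hρ₀ : 0 < ρ := by linarith
  have hε : 0 < 1 - 1 / ρ := by
    rw [sub_pos, div_lt_one hρ₀]
    exact hρ
  filter_upwards [(tendsto_add_atTop_nat 1).eventually
    ((isLittleO_cnt_diff h hs hx hwx).bound hε)] with n hn
  rw [Real.norm_of_nonneg (Nat.cast_nonneg _), Real.norm_of_nonneg (Nat.cast_nonneg _)] at hn
  have h1 : (cnt E w (n + 1) : ℝ) = cnt E w n + cnt (E \ {x}) w (n + 1) := by
    rw [cnt_eq_add_cnt_diff h hx (n + 1), if_pos (by omega), hwx]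
    simp
  have h2 : (1 / ρ) * cnt E w (n + 1) ≤ cnt E w n := by linarith
  rwa [one_div, inv_mul_le_iff₀ hρ₀] at h2

theorem SlowGrowth.isBigO_shift {a : ℕ → ℝ} (ha : SlowGrowth a) (h₀ : ∀ n, 0 ≤ a n) (k : ℕ) :
    (fun n => a (n + k)) =O[atTop] a := by
  induction k with
  | zero => exact isBigO_refl _ _
  | succ k ih =>
    refine IsBigO.trans ?_ ih
    refine IsBigO.of_bound 2 ?_
    filter_upwards [(tendsto_add_atTop_nat k).eventually (ha 2 (by norm_num))] with n hn
    rw [Real.norm_of_nonneg (h₀ _), Real.norm_of_nonneg (h₀ _)]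
    exact hn

/-- One representative, with entries at least `M`, of each residue class modulo `P` on `I`. -/
noncomputable def boxes (I : Finset ι) (P : ι → ℕ) (M : ℕ) : Finset (ι →₀ ℕ) :=
  I.finsupp fun e => Finset.Ico M (M + P e)

theorem card_boxes (I : Finset ι) (P : ι → ℕ) (M : ℕ) : (boxes I P M).card = ∏ e ∈ I, P e := by
  simp [boxes, Finset.card_finsupp]

theorem support_subset_of_mem_boxes {E : Set ι} {I : Finset ι} (hI : ↑I ⊆ E) {P : ι → ℕ} {M : ℕ}
    {c : ι →₀ ℕ} (hc : c ∈ boxes I P M) : ↑c.support ⊆ E :=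
  (Finset.coe_subset.2 (Finset.mem_finsupp_iff.1 hc).1).trans hI

theorem disjoint_resid {E : Set ι} {w P : ι → ℕ} {I : Finset ι} {M n : ℕ} {c c' : ι →₀ ℕ}
    (hc : c ∈ boxes I P M) (hc' : c' ∈ boxes I P M) (hne : c ≠ c') :
    Disjoint (resid E w P c n) (resid E w P c' n) := by
  rw [Set.disjoint_left]
  rintro f ⟨_, g, rfl⟩ ⟨_, g', hg'⟩
  refine hne (Finsupp.ext fun e => ?_)
  rw [boxes, Finset.mem_finsupp_iff] at hc hc'
  by_cases he : e ∈ I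
  · have h1 := Finset.mem_Ico.1 (hc.2 e he)
    have h2 := Finset.mem_Ico.1 (hc'.2 e he)
    have h3 : c e + P e * g e = c' e + P e * g' e := by simpa using DFunLike.congr_fun hg' e
    have h4 : (c e - M) + P e * g e = (c' e - M) + P e * g' e := by omega
    have h5 := congrArg (· % P e) h4
    simp only [Nat.add_mul_mod_self_left] at h5
    rw [Nat.mod_eq_of_lt (by omega), Nat.mod_eq_of_lt (by omega)] at h5
    omega
  · rw [Finsupp.notMem_support_iff.1 fun h => he (hc.1 h),
      Finsupp.notMem_support_iff.1 fun h => he (hc'.1 h)]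

theorem ncard_biUnion_resid {E : Set ι} {w P : ι → ℕ} (h : IsWeight E w) {I : Finset ι} {M n : ℕ}
    {T : Finset (ι →₀ ℕ)} (hT : T ⊆ boxes I P M) :
    (⋃ c ∈ T, resid E w P c n).ncard = ∑ c ∈ T, (resid E w P c n).ncard := by
  classical
  induction T using Finset.induction_on with
  | empty => simp
  | insert c T hcT ih =>
    have hfin : ∀ c, (resid E w P c n).Finite := fun c =>
      (finite_conf h n).subset (Set.sep_subset _ _)
    have hU : (⋃ c ∈ T, resid E w P c n).Finite := T.finite_toSet.biUnion fun c _ => hfin c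
    rw [Finset.set_biUnion_insert, Finset.sum_insert hcT, Set.ncard_union_eq ?_ (hfin c) hU, ih ((Finset.subset_insert _ _).trans hT)]
    refine Set.disjoint_iUnion₂_right.2 fun c' hc' => disjoint_resid (hT (by simp))
      (hT (Finset.mem_insert_of_mem hc')) ?_
    rintro rfl
    exact hcT hc'

theorem conf_eq_biUnion_resid {E : Set ι} {w P : ι → ℕ} {I : Finset ι}
    (hP : ∀ e, 0 < P e) (hPI : ∀ e ∉ I, P e = 1) (n : ℕ) :
    conf E w n = ⋃ c ∈ boxes I P 0, resid E w P c n := by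
  classical
  ext f
  simp only [Set.mem_iUnion]
  refine ⟨fun hf => ?_, fun ⟨c, _, hc⟩ => hc.1⟩
  refine ⟨Finsupp.onFinset f.support (fun e => f e % P e) fun e he => ?_, ?_, hf,
    Finsupp.onFinset f.support (fun e => f e / P e) fun e he => ?_, ?_⟩
  · rw [Finsupp.mem_support_iff]
    rintro h0
    simp [h0] at he
  · rw [boxes, Finset.mem_finsupp_iff]
    refine ⟨fun e he => ?_, fun e he => ?_⟩
    · by_contra heI
      simp [hPI e heI, Nat.mod_one] at he
    · simpa using Nat.mod_lt _ (hP e)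
  · rw [Finsupp.mem_support_iff]
    rintro h0
    simp [h0] at he
  · ext e
    simp [Nat.mod_add_div]

theorem cnt_eq_sum_boxes {E : Set ι} {w P : ι → ℕ} (h : IsWeight E w) {I : Finset ι}
    (hP : ∀ e, 0 < P e) (hPI : ∀ e ∉ I, P e = 1) (n : ℕ) :
    cnt E w n = ∑ c ∈ boxes I P 0, (resid E w P c n).ncard := by
  rw [cnt, conf_eq_biUnion_resid hP hPI, ncard_biUnion_resid h subset_rfl]

theorem cnt_mono_add {E : Set ι} {w : ι → ℕ} (h : IsWeight E w) {x : ι} (hx : x ∈ E) (n s : ℕ) :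
    cnt E w n ≤ cnt E w (n + s * w x) := by
  induction s with
  | zero => simp
  | succ s ih =>
    refine ih.trans ?_
    rw [cnt_eq_add_cnt_diff h hx (n + (s + 1) * w x), if_pos (by nlinarith)]
    refine le_add_right (le_of_eq ?_)
    congr 1
    rw [Nat.succ_mul, ← Nat.add_assoc, Nat.add_sub_cancel]

theorem isLittleO_cnt_diff_of_two {E : Set ι} {w : ι → ℕ} (h : IsWeight E w)
    (hs : SlowGrowth fun d => (parts E w d : ℝ)) {x y : ι} (hxy : x ≠ y) (hx : x ∈ E) (hy : y ∈ E)
    {K : ℕ} (hK : ∀ r ≤ w x + w y, ∃ s t, K + r = s * w x + t * w y) :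
    (fun n => (cnt (E \ {x}) w n : ℝ)) =o[atTop] fun n => (cnt E w n : ℝ) := by
  classical
  set I : Finset ι := {x, y} with hI
  set v : ι → ℕ := fun e => if e ∈ I then 1 else w e with hv
  set P : ι → ℕ := fun e => if e ∈ I then w e else 1 with hP
  have hIE : ∀ e ∈ I, e ∈ E := by simp [hI, hx, hy]
  have hPv : P * v = w := by
    ext e
    by_cases he : e ∈ I <;> simp [hv, hP, he]
  have hPpos : ∀ e, 0 < P e := fun e => by
    by_cases he : e ∈ I
    · simpa [hP, he] using h.pos e (hIE e he)
    · simp [hP, he]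
  have hPI : ∀ e ∉ I, P e = 1 := fun e he => by simp [hP, he]
  have hvI : ∀ e ∉ I, w e = v e := fun e he => by simp [hv, he]
  have hvw : IsWeight E v := h.of_eq_off (fun e he => by
    by_cases heI : e ∈ I
    · simp [hv, heI]
    · simpa [hv, heI] using h.pos e he) I hvI
  have hvx : v x = 1 := by simp [hv, hI]
  have hvs : SlowGrowth fun d => (parts E v d : ℝ) :=
    hs.congr (parts_eventuallyEq I hvI fun _ _ => Iff.rfl)
  have h1 : ∀ n, cnt (E \ {x}) w n ≤ cnt (E \ {x}) v n := by
    intro n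
    have := ncard_resid (E := E \ {x}) (w := v) hPpos (c := 0) (by simp) n
    rw [hPv, map_zero, if_pos (Nat.zero_le _), Nat.sub_zero] at this
    rw [← this]
    exact Set.ncard_le_ncard (Set.sep_subset _ _) (finite_conf (hvw.mono Set.sdiff_subset) n)
  have h2 : ∀ n, cnt E v n ≤ (boxes I P 0).card * cnt E w (n + K) := by
    intro n
    rw [cnt_eq_sum_boxes hvw hPpos hPI]
    refine Finset.sum_le_card_nsmul _ _ _ fun c hc => ?_
    rw [ncard_resid hPpos (support_subset_of_mem_boxes hIE hc), hPv]
    split_ifs with hle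
    · have hc' := Finset.mem_finsupp_iff.1 hc
      have hwt : Finsupp.weight v c ≤ w x + w y := by
        rw [Finsupp.weight_apply, Finsupp.sum_of_support_subset _ hc'.1 _ (by simp), hI,
          Finset.sum_pair hxy]
        have hcx := Finset.mem_Ico.1 (hc'.2 x (by simp [hI]))
        have hcy := Finset.mem_Ico.1 (hc'.2 y (by simp [hI]))
        have hvy : v y = 1 := by simp [hv, hI]
        have hPx : P x = w x := by simp [hP, hI]
        have hPy : P y = w y := by simp [hP, hI]
        rw [hvx, hvy, _root_.smul_eq_mul, _root_.smul_eq_mul]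
        omega
      obtain ⟨s, t, hst⟩ := hK _ hwt
      refine (cnt_mono_add h hx _ s).trans ((cnt_mono_add h hy _ t).trans_eq ?_)
      congr 1
      omega
    · exact Nat.zero_le _
  rw [← map_add_atTop_eq_nat K, isLittleO_map]
  have h3 := ((isLittleO_cnt_diff hvw hvs hx hvx).comp_tendsto (tendsto_add_atTop_nat K)).trans_isBigO
    ((slowGrowth_cnt hvw hvs hx hvx).isBigO_shift (fun n => Nat.cast_nonneg _) K)
  refine (IsBigO.trans_isLittleO (IsBigO.of_bound 1 ?_) h3).trans_isBigO
    (IsBigO.of_bound (boxes I P 0).card ?_)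
  · refine Eventually.of_forall fun n => ?_
    simpa using h1 (n + K)
  · refine Eventually.of_forall fun n => ?_
    simpa using (by exact_mod_cast h2 n : (cnt E v n : ℝ) ≤ (boxes I P 0).card * cnt E w (n + K))

/-- Two elements of consecutive weights make each of them negligibly often absent. -/
theorem isLittleO_cnt_diff_of_consecutive {E : Set ι} {w : ι → ℕ} (h : IsWeight E w)
    (hs : SlowGrowth fun d => (parts E w d : ℝ)) {x y : ι} (hx : x ∈ E) (hy : y ∈ E)
    (hxy : w y = w x + 1) :
    (fun n => (cnt (E \ {x}) w n : ℝ)) =o[atTop] (fun n => (cnt E w n : ℝ)) ∧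
      (fun n => (cnt (E \ {y}) w n : ℝ)) =o[atTop] (fun n => (cnt E w n : ℝ)) := by
  have hne : x ≠ y := by
    rintro rfl
    omega
  have key : ∀ r ≤ w x + w y, ∃ s t, (w x + w y) * w x + r = s * w x + t * w y := by
    intro r hr
    refine ⟨w x + w y - r, r, ?_⟩
    obtain ⟨s, hs⟩ := Nat.exists_eq_add_of_le hr
    rw [hs, Nat.add_sub_cancel_left, hxy]
    ring
  refine ⟨isLittleO_cnt_diff_of_two h hs hne hx hy key,
    isLittleO_cnt_diff_of_two h hs hne.symm hy hx (K := (w x + w y) * w x) fun r hr => ?_⟩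
  obtain ⟨s, t, hst⟩ := key r (by omega)
  exact ⟨t, s, by omega⟩

theorem isEquivalent_cnt_shift {E : Set ι} {w : ι → ℕ} (h : IsWeight E w) {x : ι} (hx : x ∈ E)
    (ho : (fun n => (cnt (E \ {x}) w n : ℝ)) =o[atTop] fun n => (cnt E w n : ℝ)) :
    (fun n => (cnt E w (n + w x) : ℝ)) ~[atTop] fun n => (cnt E w n : ℝ) := by
  refine IsEquivalent.symm (IsLittleO.congr' ((ho.comp_tendsto
    (tendsto_add_atTop_nat (w x))).neg_left) (Eventually.of_forall fun n => ?_) EventuallyEq.rfl)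
  simp only [Function.comp_apply, Pi.sub_apply]
  rw [cnt_eq_add_cnt_diff h hx (n + w x), if_pos (by omega), Nat.add_sub_cancel]
  push_cast
  ring

theorem isEquivalent_cnt_succ {E : Set ι} {w : ι → ℕ} (h : IsWeight E w)
    (hs : SlowGrowth fun d => (parts E w d : ℝ)) {x y : ι} (hx : x ∈ E) (hy : y ∈ E)
    (hxy : w y = w x + 1) :
    (fun n => (cnt E w (n + 1) : ℝ)) ~[atTop] fun n => (cnt E w n : ℝ) := by
  obtain ⟨h1, h2⟩ := isLittleO_cnt_diff_of_consecutive h hs hx hy hxy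
  have h3 := (isEquivalent_cnt_shift h hx h1).comp_tendsto (tendsto_add_atTop_nat 1)
  have h4 := isEquivalent_cnt_shift h hy h2
  refine h3.symm.trans (h4.congr_left (Eventually.of_forall fun n => ?_))
  simp only [Function.comp_apply, hxy]
  congr 2
  omega

theorem isEquivalent_sub {a : ℕ → ℝ} (ha : (fun n => a (n + 1)) ~[atTop] a) (k : ℕ) :
    (fun n => a (n - k)) ~[atTop] a := by
  have hadd : (fun n => a (n + k)) ~[atTop] a := by
    induction k with
    | zero => exact IsEquivalent.refl
    | succ k ih => exact (ha.comp_tendsto (tendsto_add_atTop_nat k)).trans ih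
  refine ((hadd.comp_tendsto (tendsto_sub_atTop_nat k)).congr_left ?_).symm
  filter_upwards [eventually_ge_atTop k] with n hn
  simp [Nat.sub_add_cancel hn]

theorem isEquivalent_resid {E : Set ι} {w P : ι → ℕ} (hP : ∀ e, 0 < P e) {c : ι →₀ ℕ}
    (hc : ↑c.support ⊆ E)
    (hb : (fun n => (cnt E (P * w) (n + 1) : ℝ)) ~[atTop] fun n => (cnt E (P * w) n : ℝ)) :
    (fun n => ((resid E w P c n).ncard : ℝ)) ~[atTop] fun n => (cnt E (P * w) n : ℝ) := by
  refine (isEquivalent_sub hb (Finsupp.weight w c)).congr_left ?_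
  filter_upwards [eventually_ge_atTop (Finsupp.weight w c)] with n hn
  rw [ncard_resid hP hc, if_pos hn]

theorem isLittleO_biUnion_resid {E : Set ι} {w P : ι → ℕ} (h : IsWeight E w) {I : Finset ι}
    (hI : ↑I ⊆ E) (hP : ∀ e, 0 < P e) {M : ℕ} {T : Finset (ι →₀ ℕ)} (hT : T ⊆ boxes I P M)
    (hb : (fun n => (cnt E (P * w) (n + 1) : ℝ)) ~[atTop] fun n => (cnt E (P * w) n : ℝ)) :
    (fun n => ((⋃ c ∈ T, resid E w P c n).ncard : ℝ) - T.card * cnt E (P * w) n) =o[atTop]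
      fun n => (cnt E (P * w) n : ℝ) := by
  refine (IsLittleO.sum fun c (hc : c ∈ T) =>
    isEquivalent_resid hP (support_subset_of_mem_boxes hI (hT hc)) hb).congr_left fun n => ?_
  simp [ncard_biUnion_resid h hT]

theorem add_smul_mem_iff {P : ι → ℕ} {S : Set (ι →₀ ℕ)} {I : Finset ι} {M : ℕ}
    (hS : ∀ f : ι →₀ ℕ, (∀ e ∈ I, M ≤ f e) → ∀ e, f + Finsupp.single e (P e) ∈ S ↔ f ∈ S)
    {f : ι →₀ ℕ} (hf : ∀ e ∈ I, M ≤ f e) (g : ι →₀ ℕ) : f + P • g ∈ S ↔ f ∈ S := by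
  classical
  induction g using Finsupp.induction_linear generalizing f with
  | zero =>
    rw [show P • (0 : ι →₀ ℕ) = 0 by ext; simp, add_zero]
  | add g g' ihg ihg' =>
    rw [show P • (g + g') = P • g + P • g' by ext; simp, ← add_assoc, ihg', ihg hf]
    exact fun e he => (hf e he).trans (by simp)
  | single e k =>
    induction k with
    | zero =>
      rw [show P • Finsupp.single e 0 = (0 : ι →₀ ℕ) by ext; simp, add_zero]
    | succ k ih =>
      rw [show P • Finsupp.single e (k + 1) = P • Finsupp.single e k + Finsupp.single e (P e) by
        ext e'
        rcases eq_or_ne e e' with rfl | hne <;> simp [*], ← add_assoc, hS, ih]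
      exact fun e he => (hf e he).trans (by simp)

open Classical in
/-- The proportion of residue boxes whose elements lie in `S`. -/
noncomputable def boxDensity (I : Finset ι) (P : ι → ℕ) (M : ℕ) (S : Set (ι →₀ ℕ)) : ℚ :=
  ((boxes I P M).filter (· ∈ S)).card / (boxes I P M).card

/-- A set of multisets that is eventually periodic in the multiplicities of finitely many elements
has the expected density among all multisets. -/
theorem isLittleO_ncard_inter {E : Set ι} {w P : ι → ℕ} (h : IsWeight E w)
    (hs : SlowGrowth fun d => (parts E w d : ℝ)) {I : Finset ι} (hI : ↑I ⊆ E)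
    (hP : ∀ e, 0 < P e) (hPI : ∀ e ∉ I, P e = 1) {x y : ι} (hx : x ∈ E) (hy : y ∈ E)
    (hxI : x ∉ I) (hyI : y ∉ I) (hxy : w y = w x + 1) {M : ℕ} {S : Set (ι →₀ ℕ)}
    (hS : ∀ f : ι →₀ ℕ, (∀ e ∈ I, M ≤ f e) → ∀ e, f + Finsupp.single e (P e) ∈ S ↔ f ∈ S) :
    (fun n => ((conf E w n ∩ S).ncard : ℝ) - boxDensity I P M S * cnt E w n) =o[atTop]
      fun n => (cnt E w n : ℝ) := by
  classical
  have hPw : ∀ e ∉ I, w e = (P * w) e := fun e he => by simp [hPI e he]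
  have hb := isEquivalent_cnt_succ (E := E) (w := P * w)
    (h.of_eq_off (fun e he => Nat.mul_pos (hP e) (h.pos e he)) I hPw)
    (hs.congr (parts_eventuallyEq I hPw fun _ _ => Iff.rfl)) hx hy (by simp [hPI, hxI, hyI, hxy])
  have hA := isLittleO_biUnion_resid h hI hP (M := 0) subset_rfl hb
  have hV := isLittleO_biUnion_resid h hI hP (M := M) subset_rfl hb
  have hU := isLittleO_biUnion_resid h hI hP (M := M)
    (Finset.filter_subset (· ∈ S) (boxes I P M)) hb
  simp only [← conf_eq_biUnion_resid hP hPI, card_boxes] at hA hV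
  have hbA : (fun n => (cnt E (P * w) n : ℝ)) =O[atTop] fun n => (cnt E w n : ℝ) := by
    refine IsBigO.of_bound 1 (Eventually.of_forall fun n => ?_)
    have h0 := ncard_resid (E := E) (w := w) hP (c := 0) (by simp) n
    rw [map_zero, if_pos (Nat.zero_le _), Nat.sub_zero] at h0
    have h1 : cnt E (P * w) n ≤ cnt E w n :=
      h0 ▸ Set.ncard_le_ncard (Set.sep_subset _ _) (finite_conf h n)
    simpa using h1
  have hq : (boxDensity I P M S : ℝ) * (∏ e ∈ I, P e : ℕ) =
      ((boxes I P M).filter (· ∈ S)).card := by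
    have : ((∏ e ∈ I, P e : ℕ) : ℝ) ≠ 0 := by
      exact_mod_cast (Finset.prod_pos fun e _ => hP e).ne'
    rw [boxDensity, card_boxes]
    push_cast at this ⊢
    field_simp
  have hX : (fun n => ((conf E w n ∩ S).ncard : ℝ) -
      (⋃ c ∈ (boxes I P M).filter (· ∈ S), resid E w P c n).ncard) =o[atTop]
        fun n => (cnt E (P * w) n : ℝ) := by
    refine IsBigO.trans_isLittleO (IsBigO.of_bound 1 (Eventually.of_forall fun n => ?_))
      (hA.sub hV)
    have hfin := finite_conf h n
    set U := ⋃ c ∈ (boxes I P M).filter (· ∈ S), resid E w P c n with hUdef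
    set V := ⋃ c ∈ boxes I P M, resid E w P c n with hVdef
    have hVc : V ⊆ conf E w n := Set.iUnion₂_subset fun c _ => Set.sep_subset _ _
    have hmem : ∀ c ∈ boxes I P M, ∀ f ∈ resid E w P c n, (f ∈ S ↔ c ∈ S) := by
      rintro c hc _ ⟨_, g, rfl⟩
      exact add_smul_mem_iff hS (fun e he =>
        (Finset.mem_Ico.1 ((Finset.mem_finsupp_iff.1 hc).2 e he)).1) g
    have hUX : U ⊆ conf E w n ∩ S := Set.iUnion₂_subset fun c hc f hf =>
      ⟨hf.1, (hmem c (Finset.mem_filter.1 hc).1 f hf).2 (Finset.mem_filter.1 hc).2⟩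
    have hXU : conf E w n ∩ S ⊆ U ∪ (conf E w n \ V) := by
      rintro f ⟨hf, hfS⟩
      by_cases hfV : f ∈ V
      · obtain ⟨c, hc, hfc⟩ := Set.mem_iUnion₂.1 hfV
        exact Or.inl (Set.mem_iUnion₂.2
          ⟨c, Finset.mem_filter.2 ⟨hc, (hmem c hc f hfc).1 hfS⟩, hfc⟩)
      · exact Or.inr ⟨hf, hfV⟩
    have h1 := Set.ncard_le_ncard hUX (hfin.subset Set.inter_subset_left)
    have h2 := (Set.ncard_le_ncard hXU (((hfin.subset Set.inter_subset_left).subset hUX).union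
      hfin.sdiff)).trans (Set.ncard_union_le _ _)
    have h3 := Set.ncard_sdiff_add_ncard_of_subset hVc hfin
    have h4 : (U.ncard : ℝ) ≤ (conf E w n ∩ S).ncard := by exact_mod_cast h1
    have h5 : ((conf E w n ∩ S).ncard : ℝ) ≤ U.ncard + (conf E w n \ V).ncard := by
      exact_mod_cast h2
    have h6 : ((conf E w n \ V).ncard : ℝ) + V.ncard = (conf E w n).ncard := by exact_mod_cast h3
    rw [Real.norm_of_nonneg (by linarith), one_mul]
    refine le_trans ?_ (le_abs_self _)
    linarith
  refine (((hX.add hU).sub (hA.const_mul_left (boxDensity I P M S : ℝ))).trans_isBigO hbA).congr_left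
    fun n => ?_
  rw [show (conf E w n).ncard = cnt E w n from rfl]
  linear_combination (cnt E (P * w) n : ℝ) * hq

/-- The ordinal whose Cantor normal form has the given multiplicities of exponents. -/
noncomputable def toOrd (f : Ordinal →₀ ℕ) : Ordinal :=
  CNF.eval ω (f.mapRange Nat.cast Nat.cast_zero)

/-- The multiplicities of the exponents in the Cantor normal form. -/
noncomputable def natCoeff (α : Ordinal) : Ordinal →₀ ℕ :=
  (CNF.coeff ω α).mapRange (fun x => Cardinal.toNat x.card) (by simp)

theorem coeff_lt_omega0 (α e : Ordinal) : CNF.coeff ω α e < ω := by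
  by_cases h : e ∈ (CNF ω α).map Prod.fst
  · obtain ⟨⟨e', c⟩, hm, rfl⟩ := List.mem_map.1 h
    rw [CNF.coeff_of_mem_CNF hm]
    exact CNF.snd_lt one_lt_omega0 hm
  · rw [CNF.coeff_of_notMem_CNF h]
    exact omega0_pos

theorem toOrd_natCoeff (α : Ordinal) : toOrd (natCoeff α) = α := by
  conv_rhs => rw [← CNF.eval_coeff ω α]
  rw [toOrd]
  congr 1
  ext e
  obtain ⟨k, hk⟩ := lt_omega0.1 (coeff_lt_omega0 α e)
  simp [natCoeff, hk]

theorem natCoeff_toOrd (f : Ordinal →₀ ℕ) : natCoeff (toOrd f) = f := by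
  ext e
  rw [natCoeff, toOrd, CNF.coeff_eval one_lt_omega0 fun e => by simp]
  simp

theorem support_mapRange_natCast (f : Ordinal →₀ ℕ) :
    (f.mapRange (Nat.cast : ℕ → Ordinal) Nat.cast_zero).support = f.support := by
  ext e
  simp

theorem toOrd_add {f g : Ordinal →₀ ℕ} (h : ∀ e ∈ f.support, ∀ e' ∈ g.support, e' ≤ e) :
    toOrd (f + g) = toOrd f + toOrd g := by
  rw [toOrd, toOrd, toOrd, ← CNF.eval_add]
  · congr 1
    ext e
    simp
  · simpa only [support_mapRange_natCast] using h

theorem toOrd_single (e : Ordinal) (k : ℕ) : toOrd (Finsupp.single e k) = ω ^ e * k := by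
  rw [toOrd, Finsupp.mapRange_single, CNF.eval_single]

theorem toOrd_zero : toOrd 0 = 0 := by
  rw [toOrd, Finsupp.mapRange_zero, CNF.eval_zero_right]

theorem toOrd_single_add {e : Ordinal} {f : Ordinal →₀ ℕ} (h : ∀ e' ∈ f.support, e' ≤ e) (k : ℕ) :
    toOrd (Finsupp.single e k + f) = ω ^ e * k + toOrd f := by
  rw [toOrd_add, toOrd_single]
  intro e₁ he₁
  rwa [Finset.mem_singleton.1 (Finsupp.support_single_subset he₁)]

theorem toOrd_lt_opow {f : Ordinal →₀ ℕ} {γ : Ordinal} (h : ↑f.support ⊆ Set.Iio γ) :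
    toOrd f < ω ^ γ := by
  refine CNF.eval_lt (fun e => by simp) ?_
  rw [support_mapRange_natCast]
  exact fun e he => h he

theorem support_natCoeff_subset {α γ : Ordinal} (h : α < ω ^ γ) :
    ↑(natCoeff α).support ⊆ Set.Iio γ := by
  intro e he
  by_contra hγ
  have : CNF.coeff ω α e = 0 :=
    CNF.coeff_eq_zero_of_lt (h.trans_le (opow_le_opow_right omega0_pos (not_lt.1 hγ)))
  simp [natCoeff, this] at he

theorem natCoeff_opow_add {γ α : Ordinal} (h : α < ω ^ (γ + 1)) :
    natCoeff (ω ^ γ + α) = Finsupp.single γ 1 + natCoeff α := by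
  rw [← natCoeff_toOrd (Finsupp.single γ 1 + natCoeff α), toOrd_single_add, toOrd_natCoeff,
    Nat.cast_one, mul_one]
  exact fun e he => Order.lt_add_one_iff.1 (support_natCoeff_subset h he)

theorem toOrd_mapDomain (e : Ordinal) (f : Ordinal →₀ ℕ) :
    toOrd (f.mapDomain (e + ·)) = ω ^ e * toOrd f := by
  classical
  induction f using Finsupp.induction_on_max with
  | zero => simp [toOrd_zero]
  | single_add e' k f hf hk ih =>
    rw [Finsupp.mapDomain_add, Finsupp.mapDomain_single, toOrd_single_add,
      toOrd_single_add fun e'' he => (hf e'' he).le, ih, mul_add, opow_add, mul_assoc]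
    intro e'' he
    obtain ⟨e₁, he₁, rfl⟩ := Finset.mem_image.1 (Finsupp.mapDomain_support he)
    simpa using (hf e₁ he₁).le

theorem natCoeff_opow_mul_add_apply {e x y i : Ordinal} (hy : y < ω ^ e) (hi : i < e) :
    natCoeff (ω ^ e * x + y) i = natCoeff y i := by
  classical
  have hsupp : ∀ e' ∈ ((natCoeff x).mapDomain (e + ·)).support, e ≤ e' := fun e' he' => by
    obtain ⟨e₁, _, rfl⟩ := Finset.mem_image.1 (Finsupp.mapDomain_support he')
    exact le_self_add
  have : ω ^ e * x + y = toOrd ((natCoeff x).mapDomain (e + ·) + natCoeff y) := by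
    rw [toOrd_add, toOrd_mapDomain, toOrd_natCoeff, toOrd_natCoeff]
    exact fun e₁ he₁ e₂ he₂ => (support_natCoeff_subset hy he₂).le.trans (hsupp e₁ he₁)
  rw [this, natCoeff_toOrd, Finsupp.add_apply,
    Finsupp.notMem_support_iff.1 fun h => (hsupp i h).not_gt hi, zero_add]

/-- The multiset with `k i` copies of each exponent `i ≤ r`. -/
noncomputable def lowCoeff (r : ℕ) (k : ℕ → ℕ) : Ordinal →₀ ℕ :=
  ∑ i ∈ Finset.range (r + 1), Finsupp.single (i : Ordinal) (k i)

theorem lowCoeff_apply {r i : ℕ} (k : ℕ → ℕ) (hi : i ≤ r) : lowCoeff r k i = k i := by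
  simp [lowCoeff, Finsupp.finsetSum_apply, Finsupp.single_apply, Nat.lt_succ_of_le hi]

theorem support_lowCoeff (r : ℕ) (k : ℕ → ℕ) : ↑(lowCoeff r k).support ⊆ Set.Iio ((r : Ordinal) + 1) := by
  intro e he
  by_contra h
  refine Finsupp.mem_support_iff.1 he ?_
  rw [lowCoeff, Finsupp.finsetSum_apply]
  refine Finset.sum_eq_zero fun i hi => Finsupp.single_eq_of_ne ?_
  rintro rfl
  refine h ?_
  rw [Set.mem_Iio]
  exact_mod_cast Finset.mem_range.1 hi

theorem toOrd_lowCoeff (r : ℕ) (k : ℕ → ℕ) : toOrd (lowCoeff r k) = ordOf r k := by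
  induction r with
  | zero => simp [lowCoeff, ordOf, toOrd_single]
  | succ r ih =>
    rw [lowCoeff, Finset.sum_range_succ, add_comm, ← lowCoeff, toOrd_single_add, ih]
    · simp [ordOf, List.range_succ (n := r + 1), pow_succ]
    · intro e he
      have := support_lowCoeff r k he
      exact_mod_cast this.le

theorem mem_linSetAbove_iff {α β : Ordinal} {r : ℕ} {a b : ℕ → ℕ} :
    α ∈ linSetAbove β r a b ↔ α < β ∧ ∀ i ≤ r, ∃ l, natCoeff α (i : ℕ) = a i + b i * l := by
  have hlt : ∀ i : ℕ, i ≤ r → (i : Ordinal) < (r : Ordinal) + 1 := fun i hi => by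
    exact_mod_cast Nat.lt_succ_of_le hi
  refine and_congr_right fun hα => ⟨?_, fun h => ?_⟩
  · rintro ⟨α₀, _, l, rfl⟩ i hi
    refine ⟨l i, ?_⟩
    rw [← toOrd_lowCoeff, natCoeff_opow_mul_add_apply (toOrd_lt_opow (support_lowCoeff _ _))
      (hlt i hi), natCoeff_toOrd, lowCoeff_apply _ hi]
  · choose! l hl using h
    have hpos := opow_pos ((r : Ordinal) + 1) omega0_pos
    have hmod := mod_lt α hpos.ne'
    refine ⟨α / ω ^ ((r : Ordinal) + 1), (div_le_of_le_mul (le_mul_right _ hpos)).trans_lt hα, l, ?_⟩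
    conv_lhs => rw [← div_add_mod α (ω ^ ((r : Ordinal) + 1))]
    congr 1
    rw [← toOrd_lowCoeff, ← toOrd_natCoeff (α % _)]
    congr 1
    ext e
    by_cases he : e < (r : Ordinal) + 1
    · obtain ⟨i, rfl⟩ := lt_omega0.1 (he.trans (by exact_mod_cast natCast_lt_omega0 (r + 1)))
      have hi : i ≤ r := Nat.lt_succ_iff.1 (by exact_mod_cast he)
      rw [lowCoeff_apply _ hi, ← hl i hi]
      conv_rhs => rw [← div_add_mod α (ω ^ ((r : Ordinal) + 1))]
      rw [natCoeff_opow_mul_add_apply hmod he]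
    · rw [Finsupp.notMem_support_iff.1 fun h => he (support_natCoeff_subset hmod h),
        Finsupp.notMem_support_iff.1 fun h => he (support_lowCoeff _ _ h)]

theorem lt_omega0_opow_of_lt_eps0_s18 {γ : Ordinal} (h : γ < eps0) : γ < ω ^ γ :=
  (right_le_opow γ one_lt_omega0).lt_of_ne fun he =>
    h.not_ge (csInf_le' he.symm)

theorem norm_toOrd {N : Ordinal → ℕ} (hN : IsNorm N) {f : Ordinal →₀ ℕ} (hf : toOrd f < eps0) :
    N (toOrd f) = Finsupp.weight (fun e => N e + 1) f := by
  induction f using Finsupp.induction_on_max with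
  | zero => rw [toOrd_zero, map_zero, hN.1]
  | single_add e k f hlt _ ih =>
    have hle : ∀ e' ∈ f.support, e' ≤ e := fun e' he' => (hlt e' he').le
    have key : ∀ k : ℕ, toOrd (Finsupp.single e k + f) < eps0 →
        N (toOrd (Finsupp.single e k + f)) = k * (N e + 1) + N (toOrd f) := by
      intro k
      induction k with
      | zero => simp
      | succ k ihk =>
        have hsupp : ∀ e' ∈ (Finsupp.single e k + f).support, e' ≤ e := fun e' he' => by
          rcases Finset.mem_union.1 (Finsupp.support_add he') with h | h
          · exact (Finset.mem_singleton.1 (Finsupp.support_single_subset h)).le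
          · exact hle e' h
        have hadd : toOrd (Finsupp.single e (k + 1) + f) =
            ω ^ e + toOrd (Finsupp.single e k + f) := by
          rw [add_comm k, Finsupp.single_add, add_assoc, toOrd_single_add hsupp, Nat.cast_one,
            mul_one]
        rw [hadd]
        intro hlt'
        rw [hN.2 e _ hlt' (toOrd_lt_opow fun e' he' => Order.lt_add_one_iff.2 (hsupp e' he')),
          ihk (le_add_self.trans_lt hlt')]
        ring
    rw [key k hf, map_add, Finsupp.weight_single, _root_.smul_eq_mul, ih]
    rw [toOrd_single_add hle] at hf
    exact le_add_self.trans_lt hf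

theorem IsNorm.apply_natCast.{u} {N : Ordinal.{u} → ℕ} (hN : IsNorm N) (hω : ω ≤ eps0.{u}) (i : ℕ) : N i = i := by
  induction i with
  | zero => simpa using hN.1
  | succ i ih =>
    have h1 : ((i + 1 : ℕ) : Ordinal) = ω ^ (0 : Ordinal) + i := by
      rw [opow_zero, Nat.add_comm, Nat.cast_add, Nat.cast_one]
    rw [h1, hN.2 0 i (h1 ▸ (natCast_lt_omega0 _).trans_le hω) (by simp), hN.1, ih]
    omega

/-- The ordinals below `β` of norm `n` whose coefficients lie in `S`. -/
def below (N : Ordinal → ℕ) (β : Ordinal) (S : Set (Ordinal →₀ ℕ)) (n : ℕ) : Set Ordinal :=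
  {α | α < β ∧ N α = n ∧ natCoeff α ∈ S}

theorem below_opow {N : Ordinal → ℕ} (hN : IsNorm N) {γ : Ordinal} (hγ : ω ^ γ ≤ eps0)
    (S : Set (Ordinal →₀ ℕ)) (n : ℕ) :
    below N (ω ^ γ) S n = toOrd '' (conf (Set.Iio γ) (fun e => N e + 1) n ∩ S) := by
  ext α
  constructor
  · rintro ⟨hα, hn, hS⟩
    refine ⟨natCoeff α, ⟨⟨support_natCoeff_subset hα, ?_⟩, hS⟩, toOrd_natCoeff α⟩
    rw [← norm_toOrd hN (by rw [toOrd_natCoeff]; exact hα.trans_le hγ), toOrd_natCoeff, hn]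
  · rintro ⟨f, ⟨⟨hf, hn⟩, hS⟩, rfl⟩
    have hlt := toOrd_lt_opow hf
    exact ⟨hlt, by rw [norm_toOrd hN (hlt.trans_le hγ), hn], by rwa [natCoeff_toOrd]⟩

theorem ncard_below_opow {N : Ordinal → ℕ} (hN : IsNorm N) {γ : Ordinal} (hγ : ω ^ γ ≤ eps0)
    (S : Set (Ordinal →₀ ℕ)) (n : ℕ) : (below N (ω ^ γ) S n).ncard =
      (conf (Set.Iio γ) (fun e => N e + 1) n ∩ S).ncard := by
  rw [below_opow hN hγ]
  exact Set.ncard_image_of_injective _ (Function.LeftInverse.injective natCoeff_toOrd)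

theorem below_opow_add {N : Ordinal → ℕ} (hN : IsNorm N) {γ β : Ordinal} (hβ : ω ^ γ + β < eps0)
    (hβγ : β < ω ^ (γ + 1)) {S : Set (Ordinal →₀ ℕ)}
    (hS : ∀ f, f + Finsupp.single γ 1 ∈ S ↔ f ∈ S) (n : ℕ) :
    below N (ω ^ γ + β) S n = below N (ω ^ γ) S n ∪
      (ω ^ γ + ·) '' if N γ + 1 ≤ n then below N β S (n - (N γ + 1)) else ∅ := by
  have hNadd : ∀ α < β, N (ω ^ γ + α) = N γ + 1 + N α := fun α hα => by
    rw [hN.2 γ α ((add_lt_add_right hα _).trans hβ) (hα.trans hβγ), Nat.add_comm 1]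
  have hSadd : ∀ α < β, natCoeff (ω ^ γ + α) ∈ S ↔ natCoeff α ∈ S := fun α hα => by
    rw [natCoeff_opow_add (hα.trans hβγ), add_comm, hS]
  ext α
  constructor
  · rintro ⟨hα, hn, hαS⟩
    rcases lt_or_ge α (ω ^ γ) with h | h
    · exact Or.inl ⟨h, hn, hαS⟩
    · obtain ⟨α, rfl⟩ := exists_add_of_le h
      rw [add_lt_add_iff_left] at hα
      rw [hNadd α hα] at hn
      rw [if_pos (by omega)]
      exact Or.inr ⟨α, ⟨hα, by omega, (hSadd α hα).1 hαS⟩, rfl⟩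
  · rintro (⟨h, hn, hαS⟩ | ⟨α, hα, rfl⟩)
    · exact ⟨h.trans_le le_self_add, hn, hαS⟩
    · split_ifs at hα with hle
      · obtain ⟨hα, hn, hαS⟩ := hα
        exact ⟨add_lt_add_right hα _, by rw [hNadd α hα]; omega, (hSadd α hα).2 hαS⟩
      · exact hα.elim

theorem ncard_below_opow_add {N : Ordinal → ℕ} (hN : IsNorm N) {γ β : Ordinal}
    (hβ : ω ^ γ + β < eps0) (hβγ : β < ω ^ (γ + 1)) {S : Set (Ordinal →₀ ℕ)}
    (hS : ∀ f, f + Finsupp.single γ 1 ∈ S ↔ f ∈ S) {n : ℕ}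
    (hfin : (below N (ω ^ γ + β) S n).Finite) :
    (below N (ω ^ γ + β) S n).ncard = (below N (ω ^ γ) S n).ncard +
      if N γ + 1 ≤ n then (below N β S (n - (N γ + 1))).ncard else 0 := by
  rw [below_opow_add hN hβ hβγ hS] at hfin ⊢
  rw [Set.ncard_union_eq _ (hfin.subset Set.subset_union_left)
    (hfin.subset Set.subset_union_right), Set.ncard_image_of_injective _ fun a b h => by simpa using h]
  · split_ifs <;> simp
  · rw [Set.disjoint_left]
    rintro _ ⟨h, _⟩ ⟨α, _, rfl⟩
    exact h.not_ge le_self_add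

/-- Every nonzero ordinal below `ε₀` splits off its leading term, all parts being smaller. -/
theorem exists_eq_opow_add {β : Ordinal} (hβ : β < eps0) (h0 : β ≠ 0) :
    ∃ γ β', β = ω ^ γ + β' ∧ γ < β ∧ β' < β ∧ β < ω ^ (γ + 1) := by
  have hle := opow_log_le_self ω h0
  have hlt := lt_opow_succ_log_self one_lt_omega0 β
  obtain ⟨β', h⟩ := exists_add_of_le hle
  refine ⟨log ω β, β', h, ?_, ?_, by simpa using hlt⟩
  · exact (lt_omega0_opow_of_lt_eps0_s18 ((log_le_self _ _).trans_lt hβ)).trans_le hle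
  · refine (le_add_self.trans_eq h.symm).lt_of_ne fun he => hlt.not_ge ?_
    rw [Order.succ_eq_add_one, opow_add, opow_one, ← add_eq_right_iff_mul_omega0_le]
    rw [he] at h
    exact h.symm

theorem cnt_mono {ι : Type*} {E F : Set ι} {w : ι → ℕ} (h : IsWeight F w) (hEF : E ⊆ F) (n : ℕ) :
    cnt E w n ≤ cnt F w n :=
  Set.ncard_le_ncard (fun _ hf => ⟨hf.1.trans hEF, hf.2⟩) (finite_conf h n)

theorem isWeight_of_finite_below {N : Ordinal → ℕ} {γ : Ordinal}
    (h : ∀ n, (below N γ Set.univ n).Finite) : IsWeight (Set.Iio γ) fun e => N e + 1 := by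
  refine ⟨fun _ _ => Nat.succ_pos _, fun d =>
    ((Set.finite_Iio d).biUnion fun n _ => h n).subset fun e he => ?_⟩
  exact Set.mem_iUnion₂.2 ⟨N e, he.2, he.1, rfl, trivial⟩

theorem slowGrowth_parts_of_below {N : Ordinal → ℕ} {γ : Ordinal}
    (h : SlowGrowth fun n => ((below N γ Set.univ n).ncard : ℝ)) :
    SlowGrowth fun d => (parts (Set.Iio γ) (fun e => N e + 1) d : ℝ) := by
  refine (h.comp_sub 1).congr ?_
  filter_upwards [eventually_ge_atTop 1] with d hd
  rw [parts]
  congr 2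
  ext e
  refine and_congr_right fun _ => ⟨fun he => ?_, fun he => ⟨?_, trivial⟩⟩
  · have := he.1
    omega
  · omega

theorem finite_below_and_slowGrowth {N : Ordinal → ℕ} (hN : IsNorm N) {β : Ordinal}
    (hβ : β < eps0) : (∀ n, (below N β Set.univ n).Finite) ∧
      SlowGrowth fun n => ((below N β Set.univ n).ncard : ℝ) := by
  induction β using WellFoundedLT.induction with
  | _ β ih =>
    rcases eq_or_ne β 0 with rfl | h0
    · have hempty : ∀ n, below N 0 Set.univ n = ∅ := fun n =>
        Set.eq_empty_of_forall_notMem fun α hα => (not_lt_zero hα.1)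
      simp [hempty, SlowGrowth]
    · obtain ⟨γ, β', rfl, hγ, hβ', hlt⟩ := exists_eq_opow_add hβ h0
      obtain ⟨hfγ, hsγ⟩ := ih γ hγ (hγ.trans hβ)
      obtain ⟨hfβ', hsβ'⟩ := ih β' hβ' (hβ'.trans hβ)
      have hle : ω ^ γ ≤ eps0 := le_self_add.trans hβ.le
      have hw := isWeight_of_finite_below hfγ
      have hfin : ∀ n, (below N (ω ^ γ + β') Set.univ n).Finite := fun n => by
        rw [below_opow_add hN hβ (hβ'.trans hlt) (by simp), below_opow hN hle]
        refine (((finite_conf hw n).subset Set.inter_subset_left).image _).union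
          (Set.Finite.image _ ?_)
        split_ifs
        exacts [hfβ' _, Set.finite_empty]
      refine ⟨hfin, ?_⟩
      have h1 : SlowGrowth fun n => ((below N (ω ^ γ) Set.univ n).ncard : ℝ) := by
        simp only [ncard_below_opow hN hle, Set.inter_univ]
        rcases eq_or_ne γ 0 with rfl | hγ0
        · refine SlowGrowth.congr (f := fun _ => 0) (fun ρ _ => by simp) ?_
          filter_upwards [eventually_gt_atTop 0] with n hn
          refine (Nat.cast_eq_zero.2 (Set.ncard_eq_zero (finite_conf hw n) |>.2 ?_)).symm
          refine Set.eq_empty_of_forall_notMem fun f hf => hn.ne ?_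
          have hf0 : f = 0 := Finsupp.support_eq_empty.1 <|
            Finset.eq_empty_of_forall_notMem fun e he => not_lt_zero (Set.mem_Iio.1 (hf.1 he))
          rw [← hf.2, hf0, map_zero]
        · exact slowGrowth_cnt hw (slowGrowth_parts_of_below hsγ)
            (Set.mem_Iio.2 (pos_iff_ne_zero.2 hγ0)) (by simp [hN.1])
      refine (h1.add (hsβ'.comp_sub (N γ + 1))).congr ?_
      filter_upwards [eventually_ge_atTop (N γ + 1)] with n hn
      rw [ncard_below_opow_add hN hβ (hβ'.trans hlt) (by simp) (hfin n), if_pos hn]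
      simp

theorem isWeight_Iio {N : Ordinal → ℕ} (hN : IsNorm N) {γ : Ordinal} (hγ : γ < eps0) :
    IsWeight (Set.Iio γ) fun e => N e + 1 :=
  isWeight_of_finite_below (finite_below_and_slowGrowth hN hγ).1

theorem slowGrowth_parts_Iio {N : Ordinal → ℕ} (hN : IsNorm N) {γ : Ordinal} (hγ : γ < eps0) :
    SlowGrowth fun d => (parts (Set.Iio γ) (fun e => N e + 1) d : ℝ) :=
  slowGrowth_parts_of_below (finite_below_and_slowGrowth hN hγ).2

/-- Below an ordinal smaller than `ω ^ (γ + 1)`, a set of coefficients that is eventually periodic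
in finitely many finite exponents has the expected density, up to an error negligible
against the number of ordinals below `ω ^ γ`. -/
theorem isLittleO_ncard_below {N : Ordinal → ℕ} (hN : IsNorm N) {γ : Ordinal} (hωγ : ω ≤ γ)
    (hγ' : ω ^ γ < eps0) {I : Finset Ordinal} {R : ℕ} (hI : ∀ e ∈ I, e < R) {P : Ordinal → ℕ}
    (hP : ∀ e, 0 < P e) (hPI : ∀ e ∉ I, P e = 1) {M : ℕ} {S : Set (Ordinal →₀ ℕ)}
    (hSI : ∀ f, ∀ e ∉ I, f + Finsupp.single e 1 ∈ S ↔ f ∈ S)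
    (hS : ∀ f : Ordinal →₀ ℕ, (∀ e ∈ I, M ≤ f e) → ∀ e, f + Finsupp.single e (P e) ∈ S ↔ f ∈ S)
    {β : Ordinal} (hβ : β < eps0) (hβγ : β < ω ^ (γ + 1)) :
    (fun n => ((below N β S n).ncard : ℝ) -
        boxDensity I P M S * (below N β Set.univ n).ncard) =o[atTop]
      fun n => (cnt (Set.Iio γ) (fun e => N e + 1) n : ℝ) := by
  have hγ : γ < eps0 := (right_le_opow γ one_lt_omega0).trans_lt hγ'
  set w : Ordinal → ℕ := fun e => N e + 1
  set q : ℝ := ((boxDensity I P M S : ℚ) : ℝ)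
  have hwγ : IsWeight (Set.Iio γ) w := isWeight_Iio hN hγ
  have hnat : ∀ i : ℕ, (i : Ordinal) < γ := fun i => (natCast_lt_omega0 i).trans_le hωγ
  have hwnat : ∀ i : ℕ, w i = i + 1 := fun i =>
    congrArg (· + 1) (hN.apply_natCast (hωγ.trans hγ.le) i)
  have hmono : ∀ η ≤ γ, (fun n => (cnt (Set.Iio η) w n : ℝ)) =O[atTop]
      fun n => (cnt (Set.Iio γ) w n : ℝ) := fun η hη =>
    IsBigO.of_bound 1 (Eventually.of_forall fun n => by
      simpa using cnt_mono hwγ (Set.Iio_subset_Iio hη) n)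
  have hIω : ∀ e ∈ I, e < ω := fun e he => (hI e he).trans (natCast_lt_omega0 R)
  induction β using WellFoundedLT.induction with
  | _ β ih =>
    rcases eq_or_ne β 0 with rfl | h0
    · have hempty : ∀ S n, below N 0 S n = ∅ := fun S n =>
        Set.eq_empty_of_forall_notMem fun α hα => not_lt_zero hα.1
      simpa only [hempty, Set.ncard_empty, Nat.cast_zero, mul_zero, _root_.sub_zero] using
        isLittleO_zero _ _
    obtain ⟨η, β', rfl, hη, hβ', hlt⟩ := exists_eq_opow_add hβ h0
    have hηγ : η ≤ γ := Order.lt_add_one_iff.1 <|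
      (opow_lt_opow_iff_right one_lt_omega0).1 (le_self_add.trans_lt hβγ)
    have hηε : ω ^ η ≤ eps0 := le_self_add.trans hβ.le
    have hfin := (finite_below_and_slowGrowth hN hβ).1
    rcases le_or_gt ω η with hωη | hηω
    · have hηI : η ∉ I := fun h => (hIω η h).not_ge hωη
      have hlead : (fun n => ((below N (ω ^ η) S n).ncard : ℝ) -
          q * (below N (ω ^ η) Set.univ n).ncard) =o[atTop]
            fun n => (cnt (Set.Iio γ) w n : ℝ) := by
        simp only [ncard_below_opow hN hηε, Set.inter_univ]
        have hnatη : ∀ i : ℕ, (i : Ordinal) < η := fun i => (natCast_lt_omega0 i).trans_le hωη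
        have hRI : ∀ i : ℕ, R ≤ i → (i : Ordinal) ∉ I := fun i hi h =>
          (hI _ h).not_ge (by exact_mod_cast hi)
        exact (isLittleO_ncard_inter (isWeight_Iio hN (hη.trans hβ))
          (slowGrowth_parts_Iio hN (hη.trans hβ)) (fun e he => (hIω e he).trans_le hωη) hP hPI
          (hnatη R) (hnatη (R + 1)) (hRI R le_rfl) (hRI (R + 1) (by omega))
          ((hwnat (R + 1)).trans (congrArg (· + 1) (hwnat R).symm)) hS).trans_isBigO (hmono η hηγ)
      have htail : (fun n => ((below N β' S (n - (N η + 1))).ncard : ℝ) -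
          q * (below N β' Set.univ (n - (N η + 1))).ncard) =o[atTop]
            fun n => (cnt (Set.Iio γ) w n : ℝ) := by
        refine ((ih β' hβ' (hβ'.trans hβ) (hβ'.trans hβγ)).comp_tendsto
          (tendsto_sub_atTop_nat (N η + 1))).trans_isBigO (IsBigO.of_bound 1 ?_)
        filter_upwards [eventually_ge_atTop (N η + 1)] with n hn
        have h := cnt_mono_add hwγ (x := ((0 : ℕ) : Ordinal)) (hnat 0) (n - (N η + 1)) (N η + 1)
        rw [hwnat, zero_add, mul_one, Nat.sub_add_cancel hn] at h
        simpa using h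
      refine (hlead.add htail).congr' ?_ EventuallyEq.rfl
      filter_upwards [eventually_ge_atTop (N η + 1)] with n hn
      rw [ncard_below_opow_add hN hβ (hβ'.trans hlt) (fun f => hSI f η hηI) ((hfin n).subset
          fun α hα => ⟨hα.1, hα.2.1, trivial⟩),
        ncard_below_opow_add hN hβ (hβ'.trans hlt) (by simp) (hfin n), if_pos hn, if_pos hn]
      push_cast
      ring
    · obtain ⟨k, hk⟩ := lt_omega0.1 hηω
      have hεk : ω ^ (((k + 1 : ℕ) : Ordinal)) < eps0 :=
        (opow_le_opow_right omega0_pos (hnat (k + 1)).le).trans_lt hγ'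
      have hsub : ∀ S n, (below N (ω ^ η + β') S n).ncard ≤
          cnt (Set.Iio γ \ {((k + 1 : ℕ) : Ordinal)}) w n := by
        intro S n
        have h := ncard_below_opow hN hεk.le Set.univ n
        rw [Set.inter_univ] at h
        refine (Set.ncard_le_ncard ?_ ((finite_below_and_slowGrowth hN hεk).1 n)).trans
          (h.trans_le (cnt_mono (hwγ.mono Set.sdiff_subset) ?_ n))
        · refine fun α hα => ⟨hα.1.trans ?_, hα.2.1, trivial⟩
          rwa [Nat.cast_add, Nat.cast_one, ← hk]
        · exact fun e he => ⟨he.trans (hnat (k + 1)), he.ne⟩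
      have ho := (isLittleO_cnt_diff_of_consecutive hwγ (slowGrowth_parts_Iio hN hγ)
        (hnat (k + 1)) (hnat (k + 2)) (by rw [hwnat, hwnat])).1
      refine IsBigO.trans_isLittleO (IsBigO.of_bound (1 + |q|) (Eventually.of_forall fun n => ?_)) ho
      have h1 : ((below N (ω ^ η + β') S n).ncard : ℝ) ≤ _ := Nat.cast_le.2 (hsub S n)
      have h2 : ((below N (ω ^ η + β') Set.univ n).ncard : ℝ) ≤ _ :=
        Nat.cast_le.2 (hsub Set.univ n)
      rw [Real.norm_of_nonneg (Nat.cast_nonneg _), add_mul, one_mul]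
      refine (norm_sub_le _ _).trans (add_le_add ?_ ?_)
      · rwa [Real.norm_of_nonneg (Nat.cast_nonneg _)]
      · rw [norm_mul, Real.norm_eq_abs, Real.norm_of_nonneg (Nat.cast_nonneg _)]
        gcongr

theorem exists_add_eq_add_mul_iff {a b v p : ℕ} (hv : a < v) (hp : max b 1 ∣ p) :
    (∃ l, v + p = a + b * l) ↔ ∃ l, v = a + b * l := by
  rcases Nat.eq_zero_or_pos b with rfl | hb
  · simp only [zero_mul, add_zero, exists_const]
    omega
  · rw [max_eq_left (Nat.succ_le_of_lt hb)] at hp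
    obtain ⟨t, rfl⟩ := hp
    refine ⟨fun ⟨l, hl⟩ => ⟨l - t, ?_⟩, fun ⟨l, hl⟩ => ⟨l + t, by rw [hl]; ring⟩⟩
    rw [Nat.mul_sub]
    omega

/-- The coefficients of elements of a semilinear set are eventually periodic in finitely many
finite exponents. -/
theorem exists_eventually_periodic {β : Ordinal} {L : Set Ordinal} (hL : IsSemilinearAbove β L) :
    ∃ (S : Set (Ordinal →₀ ℕ)) (I : Finset Ordinal) (R : ℕ) (P : Ordinal → ℕ) (M : ℕ),
      (∀ α, α ∈ L ↔ α < β ∧ natCoeff α ∈ S) ∧ (∀ e ∈ I, e < R) ∧ (∀ e, 0 < P e) ∧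
      (∀ e ∉ I, P e = 1) ∧ (∀ f, ∀ e ∉ I, f + Finsupp.single e 1 ∈ S ↔ f ∈ S) ∧
      ∀ f : Ordinal →₀ ℕ, (∀ e ∈ I, M ≤ f e) → ∀ e, f + Finsupp.single e (P e) ∈ S ↔ f ∈ S := by
  classical
  obtain ⟨m, r, a, b, rfl⟩ := hL
  set S : Set (Ordinal →₀ ℕ) := {f | ∃ j, ∀ i ≤ r j, ∃ l, f (i : ℕ) = a j i + b j i * l}
  set R := ∑ j, (r j + 1)
  set I : Finset Ordinal := (Finset.range R).image Nat.cast
  set p := ∏ j, ∏ i ∈ Finset.range R, max (b j i) 1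
  set P : Ordinal → ℕ := fun e => if e ∈ I then p else 1
  set M := ∑ j, ∑ i ∈ Finset.range R, a j i + 1
  have hR : ∀ j, ∀ i ≤ r j, i ∈ Finset.range R := fun j i hi => by
    have := Finset.single_le_sum (f := fun j => r j + 1) (fun _ _ => Nat.zero_le _)
      (Finset.mem_univ j)
    exact Finset.mem_range.2 (by grind)
  have hI : ∀ j, ∀ i ≤ r j, (i : Ordinal) ∈ I := fun j i hi =>
    Finset.mem_image_of_mem _ (hR j i hi)
  have hp : ∀ j, ∀ i ≤ r j, max (b j i) 1 ∣ p := fun j i hi =>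
    (Finset.dvd_prod_of_mem _ (hR j i hi)).trans
      (Finset.dvd_prod_of_mem (fun j => ∏ i ∈ Finset.range R, max (b j i) 1) (Finset.mem_univ j))
  have hM : ∀ j, ∀ i ≤ r j, a j i < M := fun j i hi =>
    Nat.lt_succ_of_le <| (Finset.single_le_sum (f := a j) (fun _ _ => Nat.zero_le _)
      (hR j i hi)).trans (Finset.single_le_sum
        (f := fun j => ∑ i ∈ Finset.range R, a j i) (fun _ _ => Nat.zero_le _) (Finset.mem_univ j))
  have hp0 : 0 < p := Finset.prod_pos fun j _ => Finset.prod_pos fun i _ => by simp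
  have hSI : ∀ f : Ordinal →₀ ℕ, ∀ e ∉ I, f + Finsupp.single e 1 ∈ S ↔ f ∈ S := by
    intro f e he
    refine exists_congr fun j => forall₂_congr fun i hi => ?_
    rw [Finsupp.add_apply, Finsupp.single_eq_of_ne (ne_of_mem_of_not_mem (hI j i hi) he), add_zero]
  refine ⟨S, I, R, P, M, fun α => ?_, fun e he => ?_, fun e => ?_, fun e he => if_neg he, hSI,
    fun f hf e => ?_⟩
  · simp only [Set.mem_iUnion, mem_linSetAbove_iff, exists_and_left]
    rfl
  · obtain ⟨i, hi, rfl⟩ := Finset.mem_image.1 he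
    exact_mod_cast Finset.mem_range.1 hi
  · by_cases he : e ∈ I <;> simp [P, he, hp0]
  · by_cases he : e ∈ I
    · refine exists_congr fun j => forall₂_congr fun i hi => ?_
      rw [Finsupp.add_apply, show P e = p from if_pos he]
      rcases eq_or_ne (i : Ordinal) e with rfl | hne
      · rw [Finsupp.single_eq_same]
        exact exists_add_eq_add_mul_iff ((hM j i hi).trans_le (hf _ he)) (hp j i hi)
      · rw [Finsupp.single_eq_of_ne hne, add_zero]
    · rw [show P e = 1 from if_neg he, hSI f e he]

end

open Filter in
/-- For `ω^ω ≤ β < ε₀` and any semilinear `L ⊆ β`, the limit density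
`lim_{n→∞} D_L(n)` exists and is a rational number. -/
theorem semilinear_density_rational (N : Ordinal → ℕ) (hN : IsNorm N)
    (β : Ordinal) (hβ₁ : omega0 ^ omega0 ≤ β) (hβ₂ : β < eps0)
    (L : Set Ordinal) (hL : IsSemilinearAbove β L)
    (D : ℕ → ℝ)
    (hD : ∀ m, D m = ({α ∈ L | N α = m}.ncard : ℝ) /
      ({α : Ordinal | α < β ∧ N α = m}.ncard : ℝ)) :
    ∃ q : ℚ, Tendsto D atTop (nhds (q : ℝ)) := by
  obtain ⟨S, I, R, P, M, hLS, hI, hP, hPI, hSI, hS⟩ := exists_eventually_periodic hL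
  have hωβ : ω ≤ β := (right_le_opow ω one_lt_omega0).trans hβ₁
  have hβ0 : β ≠ 0 := (omega0_pos.trans_le hωβ).ne'
  have hlog : ω ≤ log ω β := (opow_le_iff_le_log one_lt_omega0 hβ0).1 hβ₁
  have hle : ω ^ log ω β ≤ β := opow_log_le_self ω hβ0
  have hlt : β < ω ^ (log ω β + 1) := lt_opow_succ_log_self one_lt_omega0 β
  have hfin := (finite_below_and_slowGrowth hN hβ₂).1
  have hnum : ∀ n, {α ∈ L | N α = n} = below N β S n := fun n => by
    ext α
    simp only [below, Set.mem_ofPred_eq, hLS]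
    tauto
  have hden : ∀ n, {α : Ordinal | α < β ∧ N α = n} = below N β Set.univ n := fun n => by
    simp [below]
  have hpos : ∀ n, ((below N β Set.univ n).ncard : ℝ) ≠ 0 := fun n => by
    refine Nat.cast_ne_zero.2 (Set.ncard_ne_zero_of_mem (a := (n : Ordinal)) ?_ (hfin n))
    exact ⟨(natCast_lt_omega0 n).trans_le hωβ, hN.apply_natCast (hωβ.trans hβ₂.le) n, trivial⟩
  have hO : (fun n => (cnt (Set.Iio (log ω β)) (fun e => N e + 1) n : ℝ)) =O[atTop]
      fun n => ((below N β Set.univ n).ncard : ℝ) := by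
    refine Asymptotics.IsBigO.of_bound 1 (Eventually.of_forall fun n => ?_)
    have h1 := ncard_below_opow hN (hle.trans hβ₂.le) Set.univ n
    rw [Set.inter_univ] at h1
    have h2 : cnt (Set.Iio (log ω β)) (fun e => N e + 1) n ≤ (below N β Set.univ n).ncard :=
      h1.symm.trans_le (Set.ncard_le_ncard (fun α hα => ⟨hα.1.trans_le hle, hα.2⟩) (hfin n))
    simpa using h2
  have hlim := ((isLittleO_ncard_below hN hlog (hle.trans_lt hβ₂) hI hP hPI hSI hS hβ₂
    hlt).trans_isBigO hO).tendsto_div_nhds_zero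
  refine ⟨boxDensity I P M S, ?_⟩
  rw [← zero_add ((boxDensity I P M S : ℚ) : ℝ)]
  refine (hlim.add_const _).congr fun n => ?_
  rw [hD, hnum, hden, sub_div, mul_div_cancel_right₀ _ (hpos n), sub_add_cancel]
end
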